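/- arXiv:2003.03639 — 3 statements merged into one kernel-verified Lean document; each statement's English description precedes it below -/
import Mathlib

section
/- Let k ≥ 2 and let F, F' be minimally unsatisfiable 2-clause-sets of deficiency k. Then there are at most 4k isomorphisms from F to F', and the automorphism group of F (the group of clause-set isomorphisms from F to itself under composition) is isomorphic to a subgroup of the dihedral group with 4k elements. -/
/-- A literal: a variable (a natural number) together with a polarity. -/
abbrev Lit : Type := ℕ × Bool

/-- Complementation of literals: a fixed-point-free involution. -/
def Lit.compl (x : Lit) : Lit := (x.1, !x.2)

/-- The set of variables occurring in a clause-set. -/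
def varsOf (F : Finset (Finset Lit)) : Finset ℕ := F.biUnion (fun C => C.image Prod.fst)

/-- The literals over the variables of `F` (both polarities). -/
def litsOf (F : Finset (Finset Lit)) : Finset Lit := varsOf F ×ˢ (Finset.univ : Finset Bool)

/-- A clause is clash-free. -/
def IsClause (C : Finset Lit) : Prop := ∀ x ∈ C, Lit.compl x ∉ C

/-- A clause-set consists of clauses. -/
def IsClauseSet (F : Finset (Finset Lit)) : Prop := ∀ C ∈ F, IsClause C

/-- The truth value of a literal under a total assignment. -/
def LitVal (φ : ℕ → Bool) (x : Lit) : Bool := if x.2 then φ x.1 else !(φ x.1)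

/-- Satisfiability of a clause-set. -/
def Sat (F : Finset (Finset Lit)) : Prop := ∃ φ : ℕ → Bool, ∀ C ∈ F, ∃ x ∈ C, LitVal φ x = true

/-- Minimal unsatisfiability. -/
def MU (F : Finset (Finset Lit)) : Prop := IsClauseSet F ∧ ¬ Sat F ∧ ∀ G ⊂ F, Sat G

/-- Minimally unsatisfiable 2-clause-set. -/
def MU2 (F : Finset (Finset Lit)) : Prop := MU F ∧ ∀ C ∈ F, C.card ≤ 2

/-- The deficiency δ(F) = c(F) - n(F). -/
def deficiency (F : Finset (Finset Lit)) : ℤ := (F.card : ℤ) - ((varsOf F).card : ℤ)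

/-- Literal-degree: number of clauses containing the literal. -/
def ldeg (F : Finset (Finset Lit)) (x : Lit) : ℕ := (F.filter (fun C => x ∈ C)).card

/-- Variable-degree. -/
def vdeg (F : Finset (Finset Lit)) (v : ℕ) : ℕ := ldeg F (v, true) + ldeg F (v, false)

/-- Isomorphism of clause-sets: a bijection between the literals over the variables,
commuting with complementation, mapping one clause-set onto the other. -/
def CNFIso (F F' : Finset (Finset Lit)) (f : Lit → Lit) : Prop :=
  Set.BijOn f ↑(litsOf F) ↑(litsOf F') ∧
  (∀ x ∈ litsOf F, f (Lit.compl x) = Lit.compl (f x)) ∧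
  F.image (fun C => C.image f) = F'

/-- A digraph: a finite vertex set and a finite set of arcs. -/
structure FinDigraph (α : Type) where
  V : Finset α
  E : Finset (α × α)

/-- Well-formedness of a digraph: arcs join distinct vertices. -/
def FinDigraph.WellFormed {α : Type} (G : FinDigraph α) : Prop :=
  ∀ p ∈ G.E, p.1 ∈ G.V ∧ p.2 ∈ G.V ∧ p.1 ≠ p.2

/-- `f` is an isomorphism of digraphs from `G` to `G'`. -/
def DigraphIso {α β : Type} [DecidableEq β] (G : FinDigraph α) (G' : FinDigraph β) (f : α → β) : Prop :=
  Set.BijOn f ↑G.V ↑G'.V ∧ G.E.image (fun p => (f p.1, f p.2)) = G'.E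

/-- The implication digraph of a 2-clause-set (without the empty clause):
vertices are the literals over the variables of `F`, and there is an arc `(a,b)` iff
`{compl a} ∪ {b}` is a clause of `F` (this yields `(x̄,y),(ȳ,x)` for a clause `{x,y}`
and `(x̄,x)` for a unit-clause `{x}`). -/
def idg (F : Finset (Finset Lit)) : FinDigraph Lit :=
  ⟨litsOf F, (litsOf F ×ˢ litsOf F).filter (fun p => insert (Lit.compl p.1) {p.2} ∈ F)⟩

def FinDigraph.inDeg {α : Type} [DecidableEq α] (G : FinDigraph α) (v : α) : ℕ :=
  (G.E.filter (fun p => p.2 = v)).card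

def FinDigraph.outDeg {α : Type} [DecidableEq α] (G : FinDigraph α) (v : α) : ℕ :=
  (G.E.filter (fun p => p.1 = v)).card

/-- The standard double `m`-cycle. -/
def stdDoubleCycle (m : ℕ) : FinDigraph ℕ :=
  ⟨Finset.range m, (Finset.range m).biUnion (fun i => {(i, (i+1) % m), ((i+1) % m, i)})⟩

/-- A double `m`-cycle (`m ≥ 3`). -/
def IsDoubleCycle {α : Type} [DecidableEq α] (m : ℕ) (G : FinDigraph α) : Prop :=
  3 ≤ m ∧ ∃ f : ℕ → α, DigraphIso (stdDoubleCycle m) G f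

/-- Splitting a vertex `x` into `u`, `v` with a new arc `(u,v)`:
arcs into `x` now go into `u`, arcs out of `x` now leave `v`. -/
def SplitVertex {α : Type} [DecidableEq α] (G G' : FinDigraph α) : Prop :=
  ∃ x u v, x ∈ G.V ∧ u ∉ G.V ∧ v ∉ G.V ∧ u ≠ v ∧
    G'.V = insert u (insert v (G.V.erase x)) ∧
    G'.E = insert (u, v)
      ((G.E.filter (fun p => p.1 ≠ x ∧ p.2 ≠ x)) ∪
       ((G.E.filter (fun p => p.2 = x)).image (fun p => (p.1, u))) ∪
       ((G.E.filter (fun p => p.1 = x)).image (fun p => (v, p.2))))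

/-- Splitting an arc `(x,y)` by a new (linear) vertex `v`. -/
def SplitArc {α : Type} [DecidableEq α] (G G' : FinDigraph α) : Prop :=
  ∃ x y v, (x, y) ∈ G.E ∧ v ∉ G.V ∧
    G'.V = insert v G.V ∧
    G'.E = insert (x, v) (insert (v, y) (G.E.erase (x, y)))

/-- An `m`-weak-double-cycle: obtained from a double `m`-cycle by a finite sequence
of vertex splittings and arc splittings. -/
def IsWDC {α : Type} [DecidableEq α] (m : ℕ) (G : FinDigraph α) : Prop :=
  ∃ G₀ : FinDigraph α, IsDoubleCycle m G₀ ∧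
    Relation.ReflTransGen (fun A B => SplitVertex A B ∨ SplitArc A B) G₀ G

/-- A digraph is nonlinear if no vertex has in-degree 1 and out-degree 1. -/
def FinDigraph.Nonlinear {α : Type} [DecidableEq α] (G : FinDigraph α) : Prop :=
  ∀ v ∈ G.V, ¬ (G.inDeg v = 1 ∧ G.outDeg v = 1)

/-- Strong connectivity. -/
def StronglyConnected {α : Type} (G : FinDigraph α) : Prop :=
  ∀ a ∈ G.V, ∀ b ∈ G.V, Relation.ReflTransGen (fun x y => (x, y) ∈ G.E) a b

/-- A cycle digraph: strongly connected, at least 2 vertices, all vertices linear. -/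
def IsCycleDigraph {α : Type} [DecidableEq α] (G : FinDigraph α) : Prop :=
  G.WellFormed ∧ 2 ≤ G.V.card ∧ StronglyConnected G ∧
    ∀ v ∈ G.V, G.inDeg v = 1 ∧ G.outDeg v = 1

/-- A skew-symmetry of a digraph, as a permutation of its vertex set:
a fixed-point-free involution reversing arcs. -/
def IsSkewSym {α : Type} (G : FinDigraph α) (σ : Equiv.Perm {x // x ∈ G.V}) : Prop :=
  (∀ v, σ (σ v) = v) ∧ (∀ v, σ v ≠ v) ∧
  ∀ a b : {x // x ∈ G.V}, ((a : α), (b : α)) ∈ G.E → (((σ b : α)), ((σ a : α))) ∈ G.E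

/-- A skew-symmetry has a unit if some vertex is joined by an arc to its image. -/
def HasUnit {α : Type} (G : FinDigraph α) (σ : Equiv.Perm {x // x ∈ G.V}) : Prop :=
  ∃ v : {x // x ∈ G.V}, ((v : α), ((σ v : α))) ∈ G.E

/-- The literals over the variables of `F` are closed under complementation. -/
lemma compl_mem {F : Finset (Finset Lit)} {x : Lit} (h : x ∈ litsOf F) :
    Lit.compl x ∈ litsOf F := by
  simp only [litsOf, Lit.compl, Finset.mem_product] at h ⊢
  exact ⟨h.1, Finset.mem_univ _⟩

/-- Clause-set isomorphism, as an equivalence between the literals over the variables. -/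
def CNFIsoE (F F' : Finset (Finset Lit))
    (e : {x // x ∈ litsOf F} ≃ {x // x ∈ litsOf F'}) : Prop :=
  (∀ x : {x // x ∈ litsOf F}, (e ⟨Lit.compl x.1, compl_mem x.2⟩ : Lit) = Lit.compl (e x : Lit)) ∧
  F.image (fun C => C.image (fun y =>
      if h : y ∈ litsOf F then ((e ⟨y, h⟩ : {x // x ∈ litsOf F'}) : Lit) else y)) = F'

/-- An automorphism of a digraph, as a permutation of its vertex set preserving arcs. -/
def FinDigraphAut {α : Type} (G : FinDigraph α) (π : Equiv.Perm {x // x ∈ G.V}) : Prop :=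
  ∀ a b : {x // x ∈ G.V}, ((a : α), (b : α)) ∈ G.E ↔ ((π a : α), (π b : α)) ∈ G.E

/-- Multiplicity of the edge between `u` and `v` in the underlying multigraph of a digraph. -/
def mult {α : Type} [DecidableEq α] (G : FinDigraph α) (u v : α) : ℕ :=
  (if (u, v) ∈ G.E then 1 else 0) + (if (v, u) ∈ G.E then 1 else 0)

/-- `f` is an isomorphism between the underlying multigraphs of two digraphs. -/
def MultigraphIso {α β : Type} [DecidableEq α] [DecidableEq β]
    (G : FinDigraph α) (G' : FinDigraph β) (f : α → β) : Prop :=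
  Set.BijOn f ↑G.V ↑G'.V ∧ ∀ u ∈ G.V, ∀ v ∈ G.V, mult G u v = mult G' (f u) (f v)

/-- `f` is an isomorphism between the underlying graphs of two digraphs. -/
def GraphIso {α β : Type} (G : FinDigraph α) (G' : FinDigraph β) (f : α → β) : Prop :=
  Set.BijOn f ↑G.V ↑G'.V ∧ ∀ u ∈ G.V, ∀ v ∈ G.V,
    (((u, v) ∈ G.E ∨ (v, u) ∈ G.E) ↔ ((f u, f v) ∈ G'.E ∨ (f v, f u) ∈ G'.E))

/-- The transpose of a digraph: all arcs reversed. -/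
def FinDigraph.transpose {α : Type} [DecidableEq α] (G : FinDigraph α) : FinDigraph α :=
  ⟨G.V, G.E.image (fun p => (p.2, p.1))⟩

/-- DP-reduction on variable `v`: replace all clauses containing `v` or `v̄` by all
their non-tautological resolvents on `v`. -/
def DP (v : ℕ) (F : Finset (Finset Lit)) : Finset (Finset Lit) :=
  (F.filter (fun C => (v, true) ∉ C ∧ (v, false) ∉ C)) ∪
  ((((F.filter (fun C => (v, true) ∈ C)) ×ˢ (F.filter (fun C => (v, false) ∈ C))).image
      (fun p => (p.1.erase (v, true)) ∪ (p.2.erase (v, false)))).filter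
    (fun C => ∀ x ∈ C, Lit.compl x ∉ C))

/-- A variable is singular if one of its literals has literal-degree 1. -/
def Singular (F : Finset (Finset Lit)) (v : ℕ) : Prop :=
  ldeg F (v, true) = 1 ∨ ldeg F (v, false) = 1

/-- The "middle part" `M_n = {{v̄_1,v_2},…,{v̄_{n−1},v_n}}`, with variables `1,…,n`. -/
def Mn (n : ℕ) : Finset (Finset Lit) :=
  (Finset.Icc 1 (n - 1)).image (fun i => ({(i, false), (i + 1, true)} : Finset Lit))

def famU2 (n : ℕ) : Finset (Finset Lit) :=
  Mn n ∪ {({((1 : ℕ), true)} : Finset Lit), ({((n : ℕ), false)} : Finset Lit)}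

def famU1 (n i : ℕ) : Finset (Finset Lit) :=
  Mn n ∪ {({((1 : ℕ), true)} : Finset Lit), ({((n : ℕ), false), ((i : ℕ), false)} : Finset Lit)}

def famU0s (n i : ℕ) : Finset (Finset Lit) :=
  Mn n ∪ {({((1 : ℕ), true), ((i : ℕ), true)} : Finset Lit),
          ({((n : ℕ), false), ((i : ℕ), false)} : Finset Lit)}

def famU0 (n x y : ℕ) : Finset (Finset Lit) :=
  Mn n ∪ {({((1 : ℕ), true), ((x : ℕ), true)} : Finset Lit),
          ({((n : ℕ), false), ((y : ℕ), false)} : Finset Lit)}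

/-- Membership in one of the four families (with the stated parameter ranges). -/
def InFam (G : Finset (Finset Lit)) : Prop :=
  (∃ n, 1 ≤ n ∧ G = famU2 n) ∨
  (∃ n i, 2 ≤ n ∧ 1 ≤ i ∧ i ≤ n - 1 ∧ G = famU1 n i) ∨
  (∃ n i, 3 ≤ n ∧ 2 ≤ i ∧ 2 * i ≤ n + 1 ∧ G = famU0s n i) ∨
  (∃ n x y, 4 ≤ n ∧ 2 ≤ x ∧ x < y ∧ y ≤ n - 1 ∧ x + y ≤ n + 1 ∧ G = famU0 n x y)

/-- The number of unit-clauses of `F`. -/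
def unitCount (F : Finset (Finset Lit)) : ℕ := (F.filter (fun C => C.card = 1)).card

/-- MU 2-clause-sets of deficiency `k` with exactly `n` variables. -/
def MU2dn (k : ℤ) (n : ℕ) : Type :=
  {F : Finset (Finset Lit) // MU2 F ∧ deficiency F = k ∧ (varsOf F).card = n}

/-- Isomorphism relation on `MU2dn k n`. -/
def isoRel {k : ℤ} {n : ℕ} (F F' : MU2dn k n) : Prop := ∃ f, CNFIso F.1 F'.1 f

/-- The number of isomorphism classes of MU 2-clause-sets of deficiency `k`
with exactly `n` variables. -/
noncomputable def numClasses (k : ℤ) (n : ℕ) : ℕ := Nat.card (Quot (@isoRel k n))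

/-- Equivalence of binary bracelets of length `m`: rotations and reflections of the
cyclic index set. -/
def BraceletRel (m : ℕ) (b b' : ZMod m → Bool) : Prop :=
  ∃ (r : ZMod m) (s : Bool), ∀ i, b' i = b (if s then r - i else i + r)

/-- Digraph-isomorphism relation on nonlinear `m`-WDCs. -/
def NonlinWDCRel (m : ℕ) (G G' : {G : FinDigraph ℕ // IsWDC m G ∧ G.Nonlinear}) : Prop :=
  ∃ f : ℕ → ℕ, DigraphIso G.1 G'.1 f

/-- `H` is a subdigraph of `G`. -/
def Subdigraph {α : Type} (H G : FinDigraph α) : Prop := H.V ⊆ G.V ∧ H.E ⊆ G.E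

/-- A strongly connected digraph with an arc-reversing involution `inv` without unit arcs, in which
every arc, together with its mirror image, forms a directed cut separating every vertex from its
mirror image. -/
structure SkewDigraph (V : Type*) where
  Adj : V → V → Prop
  inv : V → V
  inv_inv : ∀ a, inv (inv a) = a
  inv_ne : ∀ a, inv a ≠ a
  skew : ∀ a b, Adj a b → Adj (inv b) (inv a)
  no_unit : ∀ a, ¬ Adj a (inv a)
  connected : ∀ U : Set V, U.Nonempty → (∀ p q, Adj p q → p ∈ U → q ∈ U) → ∀ v, v ∈ U
  exists_cut : ∀ a b, Adj a b → ∃ T : Set V, (∀ v, inv v ∈ T ↔ v ∉ T) ∧ a ∈ T ∧ b ∉ T ∧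
    ∀ p q, Adj p q → p ∈ T → q ∉ T → (p = a ∧ q = b) ∨ (p = inv b ∧ q = inv a)

namespace SkewDigraph

open Relation

variable {V : Type*} (D : SkewDigraph V)

/-- `T` separates every vertex from its mirror image, and the only arcs leaving `T` are `(a, b)`
and its mirror image. -/
structure IsCut (a b : V) (T : Set V) : Prop where
  half : ∀ v, D.inv v ∈ T ↔ v ∉ T
  left_mem : a ∈ T
  right_notMem : b ∉ T
  exits : ∀ p q, D.Adj p q → p ∈ T → q ∉ T → (p = a ∧ q = b) ∨ (p = D.inv b ∧ q = D.inv a)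

/-- A vertex with at least two outgoing arcs. -/
def Branching (c : V) : Prop := ∃ d e, d ≠ e ∧ D.Adj c d ∧ D.Adj c e

/-- An arc starting at a non-branching vertex. -/
def Fwd (p q : V) : Prop := D.Adj p q ∧ ¬ D.Branching p

/-- An arc ending at a non-merging vertex. -/
def Bwd (p q : V) : Prop := D.Adj p q ∧ ¬ D.Branching (D.inv q)

variable {D}

lemma exists_isCut {a b : V} (h : D.Adj a b) : ∃ T, D.IsCut a b T := by
  obtain ⟨T, h1, h2, h3, h4⟩ := D.exists_cut a b h
  exact ⟨T, h1, h2, h3, h4⟩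

lemma IsCut.mirror {a b : V} {T : Set V} (h : D.IsCut a b T) :
    D.IsCut (D.inv b) (D.inv a) T where
  half := h.half
  left_mem := (h.half b).2 h.right_notMem
  right_notMem := fun h' => (h.half a).1 h' h.left_mem
  exits := fun p q hpq hp hq => by
    rw [D.inv_inv, D.inv_inv]
    exact (h.exits p q hpq hp hq).symm

lemma not_closed {U : Set V} {a b : V} (ha : a ∈ U) (hb : b ∉ U)
    (h : ∀ p q, D.Adj p q → p ∈ U → q ∈ U) : False :=
  hb (D.connected U ⟨a, ha⟩ h b)

lemma eq_of_not_branching {p q r : V} (hp : ¬ D.Branching p) (h : D.Adj p q) (h' : D.Adj p r) :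
    q = r := by
  by_contra hne
  exact hp ⟨q, r, hne, h, h'⟩

lemma ne_inv {a b : V} (h : D.Adj a b) : a ≠ D.inv b := by
  rintro rfl
  exact D.no_unit (D.inv b) (by rwa [D.inv_inv])

lemma no_single_exit {U : Set V} {c d d' : V} (hd : D.Adj c d) (hd' : D.Adj c d') (hne : d ≠ d')
    (hc : c ∈ U) (hic : D.inv c ∉ U)
    (hU : ∀ p q, D.Adj p q → p ∈ U → q ∉ U → p = c ∧ q = d') : False := by
  obtain ⟨T, hT⟩ := exists_isCut hd
  have hdU : d ∈ U := by
    by_contra h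
    exact hne (hU c d hd hc h).2
  have hd'T : d' ∈ T := by
    by_contra h
    rcases hT.exits _ _ hd' hT.left_mem h with h | h
    · exact hne h.2.symm
    · exact ne_inv hd h.1
  have hid' : D.inv d' ∉ U := fun h =>
    ne_inv hd' (hU _ _ (D.skew _ _ hd') h hic).1.symm
  have hicT : D.inv c ∉ T := fun h => (hT.half c).1 h hT.left_mem
  refine not_closed (D := D) (U := {v | v ∈ T ∧ D.inv v ∉ U} ∪ U) (Or.inr hc) (b := D.inv c)
    (by simp [hicT, hic]) ?_
  rintro p q hpq (⟨hpT, hpU⟩ | hpU)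
  · by_cases hqT : q ∈ T
    · by_cases hqU : D.inv q ∈ U
      · have := (hU _ _ (D.skew _ _ hpq) hqU hpU).1
        rw [← this, D.inv_inv] at hicT
        exact absurd hqT hicT
      · exact Or.inl ⟨hqT, hqU⟩
    · rcases hT.exits _ _ hpq hpT hqT with h | h
      · exact Or.inr (h.2 ▸ hdU)
      · rw [h.1, D.inv_inv] at hpU
        exact absurd hdU hpU
  · by_cases hqU : q ∈ U
    · exact Or.inr hqU
    · obtain ⟨rfl, rfl⟩ := hU _ _ hpq hpU hqU
      exact Or.inl ⟨hd'T, hid'⟩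

lemma eq_or_eq_of_adj {a d e f : V} (hd : D.Adj a d) (he : D.Adj a e) (hf : D.Adj a f)
    (hde : d ≠ e) : f = d ∨ f = e := by
  by_contra! hne
  obtain ⟨S, hS⟩ := exists_isCut hd
  obtain ⟨T, hT⟩ := exists_isCut he
  obtain ⟨W, hW⟩ := exists_isCut hf
  have := hS.half
  have := hT.half
  have := hW.half
  have := hS.left_mem
  have := hT.left_mem
  have := hW.left_mem
  have := ne_inv hd
  have := ne_inv he
  have := ne_inv hf
  refine no_single_exit hd hf hne.1.symm (U := {v | v ∈ W ∧ (v ∈ S ∨ v ∈ T)}) (by simp [*])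
    (by simp [*]) ?_
  intro p q hpq hp hq
  have h1 := hS.exits p q hpq
  have h2 := hT.exits p q hpq
  have h3 := hW.exits p q hpq
  have h4 := hS.exits a f hf
  have h5 := hT.exits a f hf
  have h6 := hS.exits a e he
  have h7 := hT.exits a d hd
  simp only [Set.mem_ofPred_eq] at hp hq
  grind

lemma not_mem_of_mem {c d d' b : V} {S T : Set V} (hd : D.Adj c d) (hd' : D.Adj c d')
    (hne : d ≠ d') (hS : D.IsCut c d S) (hT : D.IsCut c d' T) (hb : D.Branching b) (hbc : b ≠ c)
    (hbS : b ∈ S) : b ∉ T := by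
  intro hbT
  obtain ⟨e, e', hee, he, he'⟩ := hb
  obtain ⟨W, hW⟩ := exists_isCut he
  have := hS.half
  have := hT.half
  have := hW.half
  have := hS.left_mem
  have := hT.left_mem
  have := hW.left_mem
  have := ne_inv hd
  have := ne_inv hd'
  have := ne_inv he
  have h4 := hS.exits b e he
  have h5 := hT.exits b e he
  have h6 := hS.exits c d' hd'
  have h7 := hT.exits c d hd
  have key : ∀ p q, D.Adj p q → p ∈ S → p ∈ T → ¬ (q ∈ S ∧ q ∈ T) →
      p = c ∧ (q = d ∨ q = d') := by
    intro p q hpq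
    have h1 := hS.exits p q hpq
    have h2 := hT.exits p q hpq
    grind
  have heS : e ∈ S ∧ e ∈ T := by
    have := key b e he
    grind
  by_cases hcW : c ∈ W
  · refine no_single_exit he' he hee.symm (U := {v | v ∈ W ∧ (v ∈ S ∨ v ∈ T)}) (by simp [*])
      (by simp [*]) ?_
    intro p q hpq hp hq
    have h1 := hS.exits p q hpq
    have h2 := hT.exits p q hpq
    have h3 := hW.exits p q hpq
    simp only [Set.mem_ofPred_eq] at hp hq
    grind
  · refine no_single_exit he' he hee.symm (U := {v | v ∈ W ∧ (v ∈ S ∧ v ∈ T)}) (by simp [*])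
      (by simp [*]) ?_
    intro p q hpq hp hq
    have h1 := key p q hpq
    have h3 := hW.exits p q hpq
    simp only [Set.mem_ofPred_eq] at hp hq
    grind

lemma fwd_unique {p q r : V} (h : D.Fwd p q) (h' : D.Fwd p r) : q = r :=
  eq_of_not_branching h.2 h.1 h'.1

lemma bwd_inv {p q : V} (h : D.Bwd p q) : D.Fwd (D.inv q) (D.inv p) :=
  ⟨D.skew _ _ h.1, h.2⟩

lemma fwd_inv {p q : V} (h : D.Fwd p q) : D.Bwd (D.inv q) (D.inv p) :=
  ⟨D.skew _ _ h.1, by rw [D.inv_inv]; exact h.2⟩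

lemma bwdPath_inv {p q : V} (h : ReflTransGen D.Bwd p q) :
    ReflTransGen D.Fwd (D.inv q) (D.inv p) := by
  induction h with
  | refl => exact .refl
  | tail _ h ih => exact .head (bwd_inv h) ih

lemma fwdPath_inv {p q : V} (h : ReflTransGen D.Fwd p q) :
    ReflTransGen D.Bwd (D.inv q) (D.inv p) := by
  induction h with
  | refl => exact .refl
  | tail _ h ih => exact .head (fwd_inv h) ih

lemma eq_of_fwdPath {b v : V} (hb : D.Branching b) (h : ReflTransGen D.Fwd b v) : b = v := by
  rcases h.cases_head with h | ⟨w, h, -⟩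
  · exact h
  · exact absurd hb h.2

lemma fwdPath_total {v b w : V} (h : ReflTransGen D.Fwd v b) (hw : ReflTransGen D.Fwd v w) :
    ReflTransGen D.Fwd b w ∨ ReflTransGen D.Fwd w b :=
  ReflTransGen.total_of_right_unique (fun _ _ _ => fwd_unique) h hw

lemma fwdPath_end_unique {v b b' : V} (hb : D.Branching b) (hb' : D.Branching b')
    (h : ReflTransGen D.Fwd v b) (h' : ReflTransGen D.Fwd v b') : b = b' := by
  rcases fwdPath_total h h' with h | h
  · exact eq_of_fwdPath hb h
  · exact (eq_of_fwdPath hb' h).symm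

lemma exists_fwdPath (hB : ∃ b, D.Branching b) (v : V) :
    ∃ b, D.Branching b ∧ ReflTransGen D.Fwd v b := by
  by_contra! h
  obtain ⟨b, hb⟩ := hB
  exact not_closed (D := D) (U := {w | ReflTransGen D.Fwd v w}) (a := v) .refl (h b hb)
    fun p q hpq hp => hp.tail ⟨hpq, fun hb => h p hb hp⟩

lemma not_fwdPath_inv (hB : ∃ b, D.Branching b) (v : V) : ¬ ReflTransGen D.Fwd v (D.inv v) := by
  intro h
  obtain ⟨b, hb⟩ := hB
  refine not_closed (D := D) (U := {w | ReflTransGen D.Fwd w (D.inv w)}) (a := v) (b := b) h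
    (fun h => D.inv_ne b (eq_of_fwdPath hb h).symm) ?_
  intro p q hpq hp
  rcases hp.cases_head with h | ⟨w, hpw, h⟩
  · exact absurd h.symm (D.inv_ne p)
  obtain rfl := eq_of_not_branching hpw.2 hpw.1 hpq
  rcases h.cases_tail with h | ⟨z, hwz, hz⟩
  · exact absurd (h ▸ hpq) (D.no_unit p)
  have := eq_of_not_branching hpw.2 hpq (by simpa [D.inv_inv] using D.skew _ _ hz.1)
  rw [Set.mem_ofPred_eq]
  nth_rw 2 [this]
  rwa [D.inv_inv]

lemma notMem_of_fwdPath (hB : ∃ b, D.Branching b) {c d w : V} {T : Set V}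
    (hT : D.IsCut c d T) (h : ReflTransGen D.Fwd d w) : w ∉ T := by
  intro hw
  set B : Set V := {v | ReflTransGen D.Fwd d v ∧ ReflTransGen D.Fwd v w} with hBdef
  have hdB : d ∈ B := ⟨.refl, h⟩
  have hwB : w ∈ B := ⟨h, .refl⟩
  have cons : ∀ v, v ∈ B → D.inv v ∉ B := by
    intro v h1 h2
    rcases fwdPath_total h1.1 h2.1 with h | h
    · exact not_fwdPath_inv hB _ h
    · exact not_fwdPath_inv hB (D.inv v) (by rwa [D.inv_inv])
  have step : ∀ p q, D.Adj p q → p ∈ B → p ≠ w → q ∈ B := by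
    intro p q hpq hp hpw
    rcases hp.2.cases_head with h | ⟨y, hpy, hy⟩
    · exact absurd h hpw
    · obtain rfl := eq_of_not_branching hpy.2 hpy.1 hpq
      exact ⟨hp.1.tail hpy, hy⟩
  have hiwT : D.inv w ∉ T := fun h => (hT.half w).1 h hw
  refine not_closed (D := D) (U := {v | (v ∈ T ∨ v ∈ B) ∧ D.inv v ∉ B}) (a := w) (b := D.inv w)
    ⟨.inl hw, cons w hwB⟩ (fun h => h.2 (by rwa [D.inv_inv])) ?_
  intro p q hpq hp
  have e := hT.exits p q hpq
  have hs := D.skew _ _ hpq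
  have s1 := step p q hpq
  have s2 := step _ _ hs
  have := D.no_unit
  have := cons p
  have := cons q
  have := cons (D.inv p)
  have := cons (D.inv q)
  have := D.inv_inv
  have := hT.half
  simp only [Set.mem_ofPred_eq] at hp ⊢
  by_cases hpB : p ∈ B
  · by_cases hpw : p = w
    · subst hpw
      grind
    · grind
  · grind

lemma mem_of_bwdPath (hB : ∃ b, D.Branching b) {c d w : V} {T : Set V}
    (hT : D.IsCut c d T) (h : ReflTransGen D.Bwd w c) : w ∈ T := by
  have := notMem_of_fwdPath hB hT.mirror (bwdPath_inv h)
  rw [hT.half] at this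
  exact not_not.1 this

lemma eq_of_bwdPath {b c : V} (hb : D.Branching b) (hc : D.Branching c)
    (h : ReflTransGen D.Bwd b c) : b = c := by
  by_contra hne
  obtain ⟨d, d', hdd, hd, hd'⟩ := id hc
  obtain ⟨S, hS⟩ := exists_isCut hd
  obtain ⟨T, hT⟩ := exists_isCut hd'
  exact not_mem_of_mem hd hd' hdd hS hT hb hne (mem_of_bwdPath ⟨c, hc⟩ hS h)
    (mem_of_bwdPath ⟨c, hc⟩ hT h)

lemma fwdPath_of_bwdPath {m c : V} (hc : D.Branching c) (h : ReflTransGen D.Bwd m c) :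
    ReflTransGen D.Fwd m c := by
  induction h using ReflTransGen.head_induction_on with
  | refl => exact .refl
  | @head x y hxy hyc ih =>
    by_cases hx : D.Branching x
    · rw [eq_of_bwdPath hx hc (hyc.head hxy)]
    · exact ih.head ⟨hxy.1, hx⟩

lemma bwdPath_of_fwdPath {m c : V} (hm : D.Branching (D.inv m)) (h : ReflTransGen D.Fwd m c) :
    ReflTransGen D.Bwd m c := by
  simpa only [D.inv_inv] using fwdPath_inv (fwdPath_of_bwdPath hm (fwdPath_inv h))

lemma fwdPath_start_unique {b b' c : V} (hb : D.Branching b) (hb' : D.Branching b')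
    (h : ReflTransGen D.Fwd (D.inv b) c) (h' : ReflTransGen D.Fwd (D.inv b') c) : b = b' := by
  have h1 := bwdPath_inv (bwdPath_of_fwdPath (by rwa [D.inv_inv]) h)
  have h2 := bwdPath_inv (bwdPath_of_fwdPath (by rwa [D.inv_inv]) h')
  rw [D.inv_inv] at h1 h2
  exact fwdPath_end_unique hb hb' h1 h2

lemma fwdPath_inv_swap {b c : V} (hb : D.Branching b)
    (h : ReflTransGen D.Fwd (D.inv b) c) : ReflTransGen D.Fwd (D.inv c) b := by
  simpa only [D.inv_inv] using bwdPath_inv (bwdPath_of_fwdPath (by rwa [D.inv_inv]) h)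

lemma exists_crossing {r : V → V → Prop} {a b : V} {T : Set V} (h : ReflTransGen r a b)
    (ha : a ∈ T) (hb : b ∉ T) : ∃ p q, r p q ∧ p ∈ T ∧ q ∉ T ∧ ReflTransGen r q b := by
  induction h using ReflTransGen.head_induction_on with
  | refl => exact absurd ha hb
  | @head x y hxy hyc ih =>
    by_cases hy : y ∈ T
    · exact ih hy
    · exact ⟨x, y, hxy, ha, hy, hyc⟩

lemma exists_isCut_notMem {b c : V} (hb : D.Branching b) (hc : D.Branching c) (hcb : c ≠ b) :
    ∃ e e' T, e ≠ e' ∧ D.Adj b e ∧ D.Adj b e' ∧ D.IsCut b e T ∧ c ∉ T := by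
  obtain ⟨d, d', hdd, hd, hd'⟩ := hb
  obtain ⟨S, hS⟩ := exists_isCut hd
  obtain ⟨T, hT⟩ := exists_isCut hd'
  by_cases h : c ∈ S
  · exact ⟨d', d, T, hdd.symm, hd', hd, hT, not_mem_of_mem hd hd' hdd hS hT hc hcb h⟩
  · exact ⟨d, d', S, hdd, hd, hd', hS, h⟩

lemma exits_inter {c d d' p q : V} {S T : Set V} (hd : D.Adj c d) (hd' : D.Adj c d')
    (hne : d ≠ d') (hS : D.IsCut c d S) (hT : D.IsCut c d' T) (hpq : D.Adj p q)
    (hp : p ∈ S ∩ T) (hq : q ∉ S ∩ T) : p = c := by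
  have := hS.half
  have := hT.half
  have := hS.left_mem
  have := hT.left_mem
  have := ne_inv hd
  have := ne_inv hd'
  have h6 := hS.exits c d' hd'
  have h7 := hT.exits c d hd
  have h1 := hS.exits p q hpq
  have h2 := hT.exits p q hpq
  simp only [Set.mem_inter_iff] at hp hq
  grind

lemma fwdPath_of_mem_inter {c d d' v : V} {S T : Set V} (hd : D.Adj c d) (hd' : D.Adj c d')
    (hne : d ≠ d') (hS : D.IsCut c d S) (hT : D.IsCut c d' T) (hv : v ∈ S ∩ T) :
    ReflTransGen D.Fwd v c := by
  have hc : D.Branching c := ⟨d, d', hne, hd, hd'⟩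
  obtain ⟨b, hb, h⟩ := exists_fwdPath ⟨c, hc⟩ v
  by_cases hbX : b ∈ S ∩ T
  · by_cases hbc : b = c
    · exact hbc ▸ h
    · exact absurd hbX.2 (not_mem_of_mem hd hd' hne hS hT hb hbc hbX.1)
  · obtain ⟨p, q, hpq, hp, hq, -⟩ := exists_crossing h hv hbX
    exact absurd (exits_inter hd hd' hne hS hT hpq.1 hp hq ▸ hc) hpq.2

/-- Mirror-paired branching vertices are not consecutive, unless they are the only ones. -/
lemma not_fwdPath_of_next (h3 : ∀ c c', ∃ b, D.Branching b ∧ b ≠ c ∧ b ≠ c') {c c' d : V}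
    (hc : D.Branching c) (hc' : D.Branching c') (hd : D.Adj c d) (hdc : ReflTransGen D.Fwd d c') :
    ¬ ReflTransGen D.Fwd (D.inv c') c := by
  intro bad
  have bad' := fwdPath_inv_swap hc' bad
  obtain ⟨b, hb, hbc, hbc'⟩ := h3 c c'
  obtain ⟨e, e', T, hee, he, he', hT, hcT⟩ := exists_isCut_notMem hb hc' hbc'.symm
  by_cases h : c ∈ T
  · obtain ⟨p, q, hpq, hp, hq, hqc, hpb⟩ : ∃ p q, D.Adj p q ∧ p ∈ T ∧ q ∉ T ∧
        ReflTransGen D.Fwd q c' ∧ p ≠ b := by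
      by_cases hdT : d ∈ T
      · obtain ⟨p, q, hpq, hp, hq, hqc⟩ := exists_crossing hdc hdT hcT
        exact ⟨p, q, hpq.1, hp, hq, hqc, fun h => hpq.2 (h ▸ hb)⟩
      · exact ⟨c, d, hd, h, hdT, hdc, hbc.symm⟩
    rcases hT.exits p q hpq hp hq with h | h
    · exact hpb h.1
    · exact hbc (fwdPath_start_unique hb hc (h.2 ▸ hqc) bad')
  · refine not_closed (D := D)
      (U := {v | (ReflTransGen D.Fwd v c ∨ ReflTransGen D.Fwd v c') ∧ v ∈ T})
      (a := D.inv c') (b := c) ⟨.inl bad, (hT.half _).2 hcT⟩ (fun h' => h h'.2) ?_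
    rintro p q hpq ⟨hp, hpT⟩
    have hq : ReflTransGen D.Fwd q c ∨ ReflTransGen D.Fwd q c' := by
      refine hp.imp ?_ ?_
      all_goals
        intro hp
        rcases hp.cases_head with rfl | ⟨y, hpy, hy⟩
        · contradiction
        · exact eq_of_not_branching hpy.2 hpy.1 hpq ▸ hy
    refine ⟨hq, ?_⟩
    by_contra hqT
    rcases hT.exits p q hpq hpT hqT with ⟨rfl, rfl⟩ | ⟨rfl, rfl⟩
    · exact hp.elim (fun h => hbc (eq_of_fwdPath hb h)) (fun h => hbc' (eq_of_fwdPath hb h))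
    · exact hq.elim (fun h => hbc' (fwdPath_start_unique hb hc' h bad))
        (fun h => hbc (fwdPath_start_unique hb hc h bad'))

lemma mem_of_next (h3 : ∀ c c', ∃ b, D.Branching b ∧ b ≠ c ∧ b ≠ c') {c c' d d' : V} {T : Set V}
    (hc' : D.Branching c') (hd : D.Adj c d) (hd' : D.Adj c d') (hne : d ≠ d')
    (hdc : ReflTransGen D.Fwd d c') (hT : D.IsCut c d' T) : c' ∈ T := by
  obtain ⟨S, hS⟩ := exists_isCut hd
  have hc : D.Branching c := ⟨d, d', hne, hd, hd'⟩
  have hcS := notMem_of_fwdPath ⟨c, hc⟩ hS hdc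
  by_contra hcT
  exact not_fwdPath_of_next h3 hc hc' hd hdc (fwdPath_of_mem_inter hd hd' hne hS hT
    ⟨(hS.half _).2 hcS, (hT.half _).2 hcT⟩)

lemma exists_mem_of_next (h3 : ∀ c c', ∃ b, D.Branching b ∧ b ≠ c ∧ b ≠ c') {c c' d : V}
    (hc : D.Branching c) (hc' : D.Branching c') (hd : D.Adj c d)
    (hdc : ReflTransGen D.Fwd d c') :
    ∃ e e' T, e ≠ e' ∧ D.Adj c' e ∧ D.Adj c' e' ∧ D.IsCut c' e' T ∧ c ∈ T := by
  obtain ⟨e, e', hee, he, he'⟩ := hc'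
  obtain ⟨S, hS⟩ := exists_isCut he
  obtain ⟨T, hT⟩ := exists_isCut he'
  by_cases hcT : c ∈ T
  · exact ⟨e, e', T, hee, he, he', hT, hcT⟩
  by_cases hcS : c ∈ S
  · exact ⟨e', e, S, hee.symm, he', he, hS, hcS⟩
  · exact absurd (fwdPath_inv_swap hc (fwdPath_of_mem_inter he he' hee hS hT
      ⟨(hS.half _).2 hcS, (hT.half _).2 hcT⟩))
      (not_fwdPath_of_next h3 hc ⟨e, e', hee, he, he'⟩ hd hdc)

/-- Distinct arcs leaving a vertex lead to distinct branching vertices. -/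
lemma next_injective (h3 : ∀ c c', ∃ b, D.Branching b ∧ b ≠ c ∧ b ≠ c') {c c' d d' : V}
    (hc' : D.Branching c') (hd : D.Adj c d) (hd' : D.Adj c d')
    (hdc : ReflTransGen D.Fwd d c') (hdc' : ReflTransGen D.Fwd d' c') : d = d' := by
  by_contra hne
  obtain ⟨T, hT⟩ := exists_isCut hd'
  exact notMem_of_fwdPath ⟨c', hc'⟩ hT hdc' (mem_of_next h3 hc' hd hd' hne hdc hT)

lemma next_ne (hB : ∃ b, D.Branching b) {c c' d : V} (hd : D.Adj c d)
    (hdc : ReflTransGen D.Fwd d c') : c ≠ c' := by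
  obtain ⟨T, hT⟩ := exists_isCut hd
  rintro rfl
  exact notMem_of_fwdPath hB hT hdc hT.left_mem

lemma next_symm (h3 : ∀ c c', ∃ b, D.Branching b ∧ b ≠ c ∧ b ≠ c') {c c' d : V}
    (hc : D.Branching c) (hc' : D.Branching c') (hd : D.Adj c d)
    (hdc : ReflTransGen D.Fwd d c') : ∃ e, D.Adj c' e ∧ ReflTransGen D.Fwd e c := by
  have hcc := next_ne ⟨c, hc⟩ hd hdc
  obtain ⟨d', hdd, hd'⟩ : ∃ d', d ≠ d' ∧ D.Adj c d' := by
    obtain ⟨x, y, hxy, hx, hy⟩ := id hc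
    by_cases h : d = x
    · exact ⟨y, h ▸ hxy, hy⟩
    · exact ⟨x, h, hx⟩
  obtain ⟨S, hS⟩ := exists_isCut hd'
  have hc'S := mem_of_next h3 hc' hd hd' hdd hdc hS
  obtain ⟨e, e', T, hee, he, he', hT, hcT⟩ := exists_mem_of_next h3 hc hc' hd hdc
  have exits : ∀ p q, D.Adj p q → p ∈ S ∩ T → q ∉ S ∩ T → (p = c ∧ q = d') ∨ (p = c' ∧ q = e') := by
    intro p q hpq hp hq
    have := hS.half
    have := hT.half
    have := hS.left_mem
    have := hT.left_mem
    have := ne_inv hd'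
    have := ne_inv he'
    have h6 := hS.exits c' e' he'
    have h7 := hT.exits c d' hd'
    have h1 := hS.exits p q hpq
    have h2 := hT.exits p q hpq
    have := D.inv_inv
    simp only [Set.mem_inter_iff] at hp hq
    grind
  have only : ∀ b, D.Branching b → b ∈ S ∩ T → b = c ∨ b = c' := by
    intro b hb hbK
    by_contra! hne
    obtain ⟨x, y, W, hxy, hx, hy, hW, hc'W⟩ := exists_isCut_notMem hb hc' hne.2.symm
    have hxK : x ∈ S ∩ T := by
      by_contra hxK
      rcases exits b x hx hbK hxK with h | h
      · exact hne.1 h.1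
      · exact hne.2 h.1
    have ixK : D.inv x ∉ S := fun h => (hS.half _).1 h hxK.1
    have exits' : ∀ p q, D.Adj p q → p ∈ S ∩ T → p ∈ W → ¬ (q ∈ S ∩ T ∧ q ∈ W) →
        (p = c ∧ q = d') ∨ (p = b ∧ q = x) := by
      intro p q hpq hp hpW hq
      have h1 := exits p q hpq hp
      have h2 := hW.exits p q hpq hpW
      have := hp.1
      grind
    by_cases hcW : c ∈ W
    · have hdK : d ∈ (S ∩ T) ∩ W := by
        by_contra h
        have := exits' c d hd ⟨hS.left_mem, hcT⟩ hcW h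
        grind
      obtain ⟨p, q, hpq, hp, hq, -⟩ := exists_crossing hdc hdK (fun h => hc'W h.2)
      rcases exits' p q hpq.1 hp.1 hp.2 hq with ⟨rfl, -⟩ | ⟨rfl, -⟩
      · exact hpq.2 hc
      · exact hpq.2 hb
    · refine no_single_exit (U := (S ∩ T) ∩ W) hy hx hxy.symm ⟨hbK, hW.left_mem⟩
        (fun h => (hS.half _).1 h.1.1 hbK.1) ?_
      intro p q hpq hp hq
      have := exits' p q hpq hp.1 hp.2 hq
      have := hp.2
      grind
  obtain ⟨b, hb, heb⟩ := exists_fwdPath ⟨c, hc⟩ e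
  have heK : e ∈ S ∩ T := by
    by_contra h
    have := exits c' e he ⟨hc'S, hT.left_mem⟩ h
    grind
  have hbK : b ∈ S ∩ T := by
    by_contra h
    obtain ⟨p, q, hpq, hp, hq, -⟩ := exists_crossing heb heK h
    rcases exits p q hpq.1 hp hq with ⟨rfl, -⟩ | ⟨rfl, -⟩
    · exact hpq.2 hc
    · exact hpq.2 hc'
  rcases only b hb hbK with rfl | rfl
  · exact ⟨e, he, heb⟩
  · exact absurd rfl (next_ne ⟨b, hb⟩ he heb)

end SkewDigraph

lemma two_ne_zero_zmod {n : ℕ} (hn : 3 ≤ n) : (2 : ZMod n) ≠ 0 := by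
  intro h
  have h2 : ((2 : ℕ) : ZMod n) = 0 := by exact_mod_cast h
  rw [ZMod.natCast_eq_zero_iff] at h2
  exact absurd (Nat.le_of_dvd two_pos h2) (by omega)

/-- A connected symmetric relation in which every element has exactly two neighbours. -/
structure IsCycleRel {B : Type*} (R : B → B → Prop) : Prop where
  irrefl : ∀ c, ¬ R c c
  symm : ∀ c c', R c c' → R c' c
  two : ∀ c, ∃ a b, a ≠ b ∧ ∀ x, R c x ↔ x = a ∨ x = b
  connected : ∀ U : Set B, U.Nonempty → (∀ p q, R p q → p ∈ U → q ∈ U) → ∀ v, v ∈ U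

namespace IsCycleRel

variable {B : Type*} {R : B → B → Prop}

lemma eq_or_eq (hR : IsCycleRel R) {c a b x : B} (ha : R c a) (hb : R c b) (hab : a ≠ b)
    (hx : R c x) : x = a ∨ x = b := by
  obtain ⟨a', b', -, h⟩ := hR.two c
  rw [h] at ha hb hx
  grind

lemma exists_other (hR : IsCycleRel R) (c a : B) : ∃ b, R c b ∧ b ≠ a := by
  obtain ⟨a', b', hab, h⟩ := hR.two c
  by_cases ha : a' = a
  · exact ⟨b', (h b').2 (.inr rfl), fun hb => hab (ha.trans hb.symm)⟩
  · exact ⟨a', (h a').2 (.inl rfl), ha⟩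

lemma exists_walk (hR : IsCycleRel R) (c : B) :
    ∃ x : ℕ → B, (∀ m, R (x m) (x (m + 1))) ∧ ∀ m, x (m + 2) ≠ x m := by
  choose f hf using hR.exists_other
  let w : ℕ → B × B := fun m => (fun p => (p.2, f p.2 p.1))^[m] (c, f c c)
  have hw : ∀ m, w (m + 1) = ((w m).2, f (w m).2 (w m).1) := fun m =>
    Function.iterate_succ_apply' _ _ _
  refine ⟨fun m => (w m).1, fun m => ?_, fun m => ?_⟩
  · cases m <;> simp only [hw]
    · exact (hf c c).1
    · exact (hf _ _).1
  · simp only [hw]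
    exact (hf _ _).2

lemma exists_closed_walk [Finite B] (hR : IsCycleRel R) (c : B) :
    ∃ (n : ℕ) (x : ℕ → B), 3 ≤ n ∧ x n = x 0 ∧ (∀ i j, i < n → j < n → x i = x j → i = j) ∧
      ∀ m, R (x m) (x (m + 1)) := by
  classical
  obtain ⟨x, hx, hx2⟩ := hR.exists_walk c
  have hrep : ∃ j, ∃ i < j, x i = x j := by
    obtain ⟨i, j, hij, h⟩ := Finite.exists_ne_map_eq_of_infinite x
    rcases hij.lt_or_gt with hij | hij
    · exact ⟨j, i, hij, h⟩
    · exact ⟨i, j, hij, h.symm⟩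
  obtain ⟨i, hij, hxij⟩ := Nat.find_spec hrep
  have hmin := fun m => Nat.find_min hrep (m := m)
  set j := Nat.find hrep
  have hinj : ∀ a b, a < j → b < j → x a = x b → a = b := by
    intro a b ha hb hab
    by_contra hne
    rcases Ne.lt_or_gt hne with h | h
    · exact hmin b hb ⟨a, h, hab⟩
    · exact hmin a ha ⟨b, h, hab.symm⟩
  have h1 : ∀ i, x i ≠ x (i + 1) := fun i h => hR.irrefl _ (by have := hx i; rwa [← h] at this)
  have hi : i = 0 := by
    by_contra hi
    obtain ⟨a, rfl⟩ := Nat.exists_eq_succ_of_ne_zero hi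
    obtain ⟨b, hb⟩ := Nat.exists_eq_succ_of_ne_zero (Nat.ne_of_gt (Nat.zero_lt_of_lt hij))
    rw [hb] at hxij hij hinj
    simp only [Nat.succ_eq_add_one] at *
    have := hR.eq_or_eq (hR.symm _ _ (hx a)) (hx (a + 1)) (hx2 a).symm
      (x := x b) (by rw [hxij]; exact hR.symm _ _ (hx b))
    rcases this with h | h
    · have := hinj b a (by omega) (by omega) h
      omega
    · rcases Nat.lt_or_ge (a + 2) (b + 1) with h' | h'
      · have := hinj b (a + 2) (by omega) (by omega) h
        subst this
        exact hx2 (a + 1) hxij.symm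
      · have : b = a + 1 := by omega
        subst this
        exact h1 _ h
  subst hi
  refine ⟨j, x, ?_, hxij.symm, hinj, hx⟩
  by_contra h
  have : j = 1 ∨ j = 2 := by omega
  rcases this with h | h <;> rw [h] at hxij
  · exact h1 0 hxij
  · exact hx2 0 hxij.symm

/-- Such a relation is the neighbourhood relation of a cycle. -/
theorem exists_equiv_zmod [Finite B] [Nonempty B] (hR : IsCycleRel R) :
    ∃ y : ZMod (Nat.card B) ≃ B, ∀ i z, R (y i) z ↔ z = y (i - 1) ∨ z = y (i + 1) := by
  obtain ⟨n, x, hn, hxn, hinj, hx⟩ := hR.exists_closed_walk (Classical.arbitrary B)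
  have : NeZero n := ⟨by omega⟩
  let y : ZMod n → B := fun i => x i.val
  have hy : ∀ m ≤ n, y (m : ZMod n) = x m := by
    intro m hm
    rcases hm.lt_or_eq with h | rfl
    · simp only [y, ZMod.val_natCast_of_lt h]
    · simp [y, hxn]
  have hcast : ∀ i : ZMod n, ∃ m < n, i = (m : ZMod n) := fun i =>
    ⟨i.val, i.val_lt, (ZMod.natCast_zmod_val i).symm⟩
  have hyinj : Function.Injective y := fun i j hij =>
    ZMod.val_injective n (hinj _ _ i.val_lt j.val_lt hij)
  have hsucc : ∀ i, R (y i) (y (i + 1)) := by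
    intro i
    obtain ⟨m, hm, rfl⟩ := hcast i
    rw [hy m hm.le, ← Nat.cast_succ, hy _ hm]
    exact hx m
  have hpred : ∀ i, R (y i) (y (i - 1)) := fun i =>
    hR.symm _ _ (by simpa using hsucc (i - 1))
  have hne : ∀ i, y (i - 1) ≠ y (i + 1) := by
    intro i h
    exact two_ne_zero_zmod hn (by linear_combination -(hyinj h))
  have hiff : ∀ i z, R (y i) z ↔ z = y (i - 1) ∨ z = y (i + 1) := by
    refine fun i z => ⟨hR.eq_or_eq (hpred i) (hsucc i) (hne i), ?_⟩
    rintro (rfl | rfl)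
    exacts [hpred i, hsucc i]
  have hsurj : Function.Surjective y := by
    refine hR.connected (Set.range y) ⟨_, 0, rfl⟩ ?_
    rintro _ q hpq ⟨i, rfl⟩
    rcases (hiff i q).1 hpq with rfl | rfl
    exacts [⟨_, rfl⟩, ⟨_, rfl⟩]
  let e := Equiv.ofBijective y ⟨hyinj, hsurj⟩
  obtain rfl : Nat.card B = n := by rw [← Nat.card_congr e, Nat.card_zmod]
  exact ⟨e, hiff⟩

end IsCycleRel

/-- The action of the dihedral group on the vertices of a polygon. -/
def DihedralGroup.onZMod {n : ℕ} : DihedralGroup n → ZMod n → ZMod n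
  | .r a, i => a + i
  | .sr a, i => -a - i

namespace DihedralGroup

lemma onZMod_mul {n : ℕ} (g h : DihedralGroup n) (i : ZMod n) :
    (g * h).onZMod i = g.onZMod (h.onZMod i) := by
  rcases g with a | a <;> rcases h with b | b <;> simp [onZMod] <;> ring

lemma onZMod_injective {n : ℕ} (hn : 3 ≤ n) :
    Function.Injective (onZMod : DihedralGroup n → ZMod n → ZMod n) := by
  intro g h hgh
  have h0 := congrFun hgh 0
  have h1 := congrFun hgh 1
  have h2 := two_ne_zero_zmod hn
  rcases g with a | a <;> rcases h with b | b <;> simp only [onZMod] at h0 h1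
  · simpa using h0
  · exact absurd (by linear_combination h1 - h0) h2
  · exact absurd (by linear_combination h0 - h1) h2
  · simpa using h0

end DihedralGroup

/-- An isomorphism between cycles acts by an element of the dihedral group. -/
theorem exists_dihedral {B B' : Type*} {R : B → B → Prop} {R' : B' → B' → Prop} {n : ℕ}
    {y : ZMod n ≃ B} {y' : ZMod n ≃ B'} (hn : 3 ≤ n)
    (hy : ∀ i z, R (y i) z ↔ z = y (i - 1) ∨ z = y (i + 1))
    (hy' : ∀ i z, R' (y' i) z ↔ z = y' (i - 1) ∨ z = y' (i + 1))
    {f : B → B'} (hf : Function.Injective f) (hR : ∀ a b, R a b → R' (f a) (f b)) :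
    ∃ g : DihedralGroup n, ∀ i, f (y i) = y' (g.onZMod i) := by
  have h2 := two_ne_zero_zmod hn
  have : NeZero n := ⟨by omega⟩
  obtain ⟨a, ha⟩ := y'.surjective (f (y 0))
  have step : ∀ i, R' (f (y i)) (f (y (i + 1))) := fun i => hR _ _ ((hy i _).2 (.inr rfl))
  have skip : ∀ i, f (y (i + 1 + 1)) ≠ f (y i) := by
    intro i h
    have := y.injective (hf h)
    exact h2 (by linear_combination this)
  have main : ∀ s : ZMod n, (s = 1 ∨ s = -1) → f (y 1) = y' (a + s) →
      ∀ i, f (y i) = y' (a + s * i) := by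
    intro s hs h1
    have key : ∀ m : ℕ, f (y (m : ZMod n)) = y' (a + s * m) ∧
        f (y (m + 1 : ZMod n)) = y' (a + s * (m + 1)) := by
      intro m
      induction m with
      | zero => simp [ha, h1]
      | succ m ih =>
        push_cast
        refine ⟨ih.2, ?_⟩
        have := step (m + 1)
        have hk := skip m
        rw [ih.2, hy'] at this
        rw [ih.1] at hk
        have e1 : a + s * (m + 1) - s = a + s * m := by ring
        have e2 : a + s * (m + 1) + s = a + s * (m + 1 + 1) := by ring
        rcases hs with rfl | rfl
        · rw [e1, e2] at this
          exact this.resolve_left hk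
        · rw [sub_neg_eq_add, ← sub_eq_add_neg] at *
          grind
    intro i
    have := (key i.val).1
    rwa [ZMod.natCast_zmod_val] at this
  have h1 := step 0
  rw [← ha, hy', zero_add] at h1
  rcases h1 with h1 | h1
  · refine ⟨.sr (-a), fun i => ?_⟩
    rw [main (-1) (.inr rfl) (by rw [h1, sub_eq_add_neg]) i]
    simp only [DihedralGroup.onZMod]
    ring_nf
  · refine ⟨.r a, fun i => ?_⟩
    rw [main 1 (.inl rfl) h1 i, one_mul]
    rfl

namespace SkewDigraph

open Relation

variable {V V' : Type*} {D : SkewDigraph V} {D' : SkewDigraph V'}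

lemma exists_branching_ne (hcard : 3 ≤ Nat.card {b // D.Branching b}) (c c' : V) :
    ∃ b, D.Branching b ∧ b ≠ c ∧ b ≠ c' := by
  by_contra! h
  have hsub : {b | D.Branching b} ⊆ {c, c'} := fun b hb => by
    by_cases hbc : b = c
    · exact .inl hbc
    · exact .inr (h b hb hbc)
  have h1 := Set.ncard_le_ncard hsub (Set.toFinite _)
  have h2 := Set.ncard_insert_le c {c'}
  rw [Set.ncard_singleton] at h2
  have h3 : Set.ncard {b | D.Branching b} = Nat.card {b // D.Branching b} := rfl
  omega

/-- Two branching vertices joined by a path whose interior vertices are not branching. -/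
def Next (D : SkewDigraph V) (c c' : {b // D.Branching b}) : Prop :=
  ∃ d, D.Adj c d ∧ ReflTransGen D.Fwd d c'

lemma isCycleRel_next (hcard : 3 ≤ Nat.card {b // D.Branching b}) : IsCycleRel D.Next where
  irrefl := by
    rintro ⟨c, hc⟩ ⟨d, hd, hdc⟩
    exact next_ne ⟨c, hc⟩ hd hdc rfl
  symm := by
    rintro ⟨c, hc⟩ ⟨c', hc'⟩ ⟨d, hd, hdc⟩
    exact next_symm (exists_branching_ne hcard) hc hc' hd hdc
  two := by
    rintro ⟨c, hc⟩
    obtain ⟨d, d', hne, hd, hd'⟩ := id hc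
    obtain ⟨b, hb, hdb⟩ := exists_fwdPath ⟨c, hc⟩ d
    obtain ⟨b', hb', hdb'⟩ := exists_fwdPath ⟨c, hc⟩ d'
    refine ⟨⟨b, hb⟩, ⟨b', hb'⟩, fun h => hne ?_, ?_⟩
    · obtain rfl := congrArg Subtype.val h
      exact next_injective (exists_branching_ne hcard) hb hd hd' hdb hdb'
    · rintro ⟨x, hx⟩
      constructor
      · rintro ⟨e, he, hex⟩
        rcases eq_or_eq_of_adj hd hd' he hne with rfl | rfl
        · exact .inl (Subtype.ext (fwdPath_end_unique hx hb hex hdb))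
        · exact .inr (Subtype.ext (fwdPath_end_unique hx hb' hex hdb'))
      · rintro (h | h) <;> obtain rfl := congrArg Subtype.val h
        exacts [⟨d, hd, hdb⟩, ⟨d', hd', hdb'⟩]
  connected := by
    rintro U ⟨⟨u, hu⟩, huU⟩ hU ⟨v, hv⟩
    obtain ⟨h, hvU⟩ := D.connected
      {w | ∃ b : {b // D.Branching b}, ReflTransGen D.Fwd w b ∧ b ∈ U}
      ⟨u, ⟨u, hu⟩, .refl, huU⟩ (by
        rintro p q hpq ⟨b, hpb, hb⟩
        rcases hpb.cases_head with rfl | ⟨y, hpy, hy⟩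
        · obtain ⟨c, hc, hqc⟩ := exists_fwdPath ⟨_, b.2⟩ q
          exact ⟨⟨c, hc⟩, hqc, hU b _ ⟨q, hpq, hqc⟩ hb⟩
        · obtain rfl := eq_of_not_branching hpy.2 hpy.1 hpq
          exact ⟨b, hy, hb⟩) v
    obtain rfl : (⟨v, hv⟩ : {b // D.Branching b}) = h := Subtype.ext (eq_of_fwdPath hv hvU.1)
    exact hvU.2

/-- Cyclic coordinates for the branching vertices. -/
lemma exists_coordinates {n : ℕ} (hn : 3 ≤ n) (hcard : Nat.card {b // D.Branching b} = n) :
    ∃ y : ZMod n ≃ {b // D.Branching b},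
      ∀ i z, D.Next (y i) z ↔ z = y (i - 1) ∨ z = y (i + 1) := by
  subst hcard
  obtain ⟨_, _⟩ := Nat.card_pos_iff.1 (by omega : 0 < Nat.card {b // D.Branching b})
  exact (isCycleRel_next hn).exists_equiv_zmod

/-- An equivalence of vertices that preserves and reflects arcs. -/
def IsIso (D : SkewDigraph V) (D' : SkewDigraph V') (e : V ≃ V') : Prop :=
  ∀ a b, D.Adj a b ↔ D'.Adj (e a) (e b)

namespace IsIso

variable {e e' : V ≃ V'}

lemma branching_iff (he : IsIso D D' e) (c : V) : D'.Branching (e c) ↔ D.Branching c := by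
  constructor
  · rintro ⟨d, d', hne, hd, hd'⟩
    obtain ⟨d, rfl⟩ := e.surjective d
    obtain ⟨d', rfl⟩ := e.surjective d'
    exact ⟨d, d', fun h => hne (congrArg e h), (he _ _).2 hd, (he _ _).2 hd'⟩
  · rintro ⟨d, d', hne, hd, hd'⟩
    exact ⟨e d, e d', e.injective.ne hne, (he _ _).1 hd, (he _ _).1 hd'⟩

lemma map_fwdPath (he : IsIso D D' e) {v w : V} (h : ReflTransGen D.Fwd v w) :
    ReflTransGen D'.Fwd (e v) (e w) :=
  h.lift e fun a b hab => ⟨(he a b).1 hab.1, fun hb => hab.2 ((he.branching_iff a).1 hb)⟩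

lemma exists_dihedral (he : IsIso D D' e) {n : ℕ} (hn : 3 ≤ n)
    {y : ZMod n ≃ {b // D.Branching b}} {y' : ZMod n ≃ {b // D'.Branching b}}
    (hy : ∀ i z, D.Next (y i) z ↔ z = y (i - 1) ∨ z = y (i + 1))
    (hy' : ∀ i z, D'.Next (y' i) z ↔ z = y' (i - 1) ∨ z = y' (i + 1)) :
    ∃ g : DihedralGroup n, ∀ i, e (y i) = y' (g.onZMod i) := by
  obtain ⟨g, hg⟩ := _root_.exists_dihedral hn hy hy'
    (f := fun b => ⟨e b, (he.branching_iff _).2 b.2⟩)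
    (fun a b hab => Subtype.ext (e.injective (congrArg Subtype.val hab)))
    (fun a b ⟨d, hd, hdb⟩ => ⟨e d, (he _ _).1 hd, he.map_fwdPath hdb⟩)
  exact ⟨g, fun i => congrArg Subtype.val (hg i)⟩

/-- An isomorphism is determined by its values on branching vertices. -/
lemma eq_of_eqOn (he : IsIso D D' e) (he' : IsIso D D' e')
    (hcard : 3 ≤ Nat.card {b // D.Branching b}) (h : ∀ b, D.Branching b → e b = e' b) :
    e = e' := by
  have h3 : ∀ c c', ∃ b, D'.Branching b ∧ b ≠ c ∧ b ≠ c' := by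
    intro c c'
    obtain ⟨b, hb, hc, hc'⟩ := exists_branching_ne hcard (e.symm c) (e.symm c')
    exact ⟨e b, (he.branching_iff b).2 hb, fun h => hc (by simp [← h]),
      fun h => hc' (by simp [← h])⟩
  obtain ⟨⟨b, hb⟩⟩ := (Nat.card_pos_iff.1 (by omega : 0 < Nat.card {b // D.Branching b})).1
  refine Equiv.ext (D.connected {v | e v = e' v} ⟨b, h b hb⟩ fun p q hpq hp => ?_)
  have h1 := (he p q).1 hpq
  have h2 := (he' p q).1 hpq
  rw [Set.mem_ofPred_eq] at hp
  rw [← hp] at h2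
  by_cases hbp : D.Branching p
  · obtain ⟨c, hc, hqc⟩ := exists_fwdPath ⟨b, hb⟩ q
    exact next_injective h3 ((he.branching_iff c).2 hc) h1 h2 (he.map_fwdPath hqc)
      (h c hc ▸ he'.map_fwdPath hqc)
  · exact eq_of_not_branching (fun h => hbp ((he.branching_iff p).1 h)) h1 h2

end IsIso

variable {n : ℕ}

/-- The isomorphisms embed into a dihedral group. -/
lemma exists_embedding_dihedral (hn : 3 ≤ n) (hD : Nat.card {b // D.Branching b} = n)
    (hD' : Nat.card {b // D'.Branching b} = n) :
    ∃ φ : {e // D.IsIso D' e} → DihedralGroup n, Function.Injective φ := by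
  obtain ⟨y, hy⟩ := exists_coordinates hn hD
  obtain ⟨y', hy'⟩ := exists_coordinates hn hD'
  choose φ hφ using fun e : {e // D.IsIso D' e} => e.2.exists_dihedral hn hy hy'
  refine ⟨φ, fun e e' h => Subtype.ext (e.2.eq_of_eqOn e'.2 (hD.symm ▸ hn) fun b hb => ?_)⟩
  obtain ⟨i, hi⟩ := y.surjective ⟨b, hb⟩
  have h1 := hφ e i
  rw [h, ← hφ e' i, hi] at h1
  exact h1

/-- The automorphism group embeds into a dihedral group. -/
lemma exists_hom_dihedral (hn : 3 ≤ n) (hD : Nat.card {b // D.Branching b} = n) :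
    ∃ φ : {π : Equiv.Perm V // D.IsIso D π} → DihedralGroup n, Function.Injective φ ∧
      ∀ (a b : {π : Equiv.Perm V // D.IsIso D π}) (hab : D.IsIso D (a.1 * b.1)),
        φ ⟨a.1 * b.1, hab⟩ = φ a * φ b := by
  obtain ⟨y, hy⟩ := exists_coordinates hn hD
  choose φ hφ using fun e : {π : Equiv.Perm V // D.IsIso D π} => e.2.exists_dihedral hn hy hy
  refine ⟨φ, fun e e' h => Subtype.ext (e.2.eq_of_eqOn e'.2 (hD.symm ▸ hn) fun b hb => ?_),
    fun a b hab => DihedralGroup.onZMod_injective hn (funext fun i => ?_)⟩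
  · obtain ⟨i, hi⟩ := y.surjective ⟨b, hb⟩
    have h1 := hφ e i
    rw [h, ← hφ e' i, hi] at h1
    exact h1
  · have h1 := hφ ⟨a.1 * b.1, hab⟩ i
    rw [Equiv.Perm.mul_apply, hφ b i, hφ a, ← DihedralGroup.onZMod_mul] at h1
    exact (y.injective (Subtype.ext h1)).symm

lemma exists_adj (v : V) : ∃ w, D.Adj v w := by
  by_contra! h
  exact D.inv_ne v (D.connected {v} ⟨v, rfl⟩ (fun p q hpq hp => absurd (hp ▸ hpq) (h q)) _)

end SkewDigraph

lemma Lit.compl_compl (x : Lit) : x.compl.compl = x := by simp [Lit.compl]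

lemma Lit.compl_ne (x : Lit) : x.compl ≠ x := by
  rcases x with ⟨v, b⟩
  cases b <;> simp [Lit.compl]

lemma Lit.compl_injective : Function.Injective Lit.compl :=
  Function.LeftInverse.injective Lit.compl_compl

lemma litVal_compl (φ : ℕ → Bool) (x : Lit) : LitVal φ x.compl = !LitVal φ x := by
  rcases x with ⟨v, b⟩
  cases b <;> simp [LitVal, Lit.compl]

lemma Lit.eq_or_eq_compl {x y : Lit} (h : x.1 = y.1) : x = y ∨ x = y.compl := by
  rcases x with ⟨v, b⟩
  rcases y with ⟨w, c⟩
  obtain rfl : v = w := h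
  cases b <;> cases c <;> simp [Lit.compl]

/-- A literal set without complementary pair. -/
def Consistent (T : Set Lit) : Prop := ∀ x ∈ T, x.compl ∉ T

lemma Consistent.exists_extend {T : Set Lit} (hT : Consistent T) (ψ : ℕ → Bool) :
    ∃ φ, (∀ x ∈ T, LitVal φ x = true) ∧
      ∀ x, x ∉ T → x.compl ∉ T → LitVal φ x = LitVal ψ x := by
  classical
  refine ⟨fun v => if (v, true) ∈ T then true else if (v, false) ∈ T then false else ψ v, ?_, ?_⟩
  · rintro ⟨v, b⟩ hx
    have := hT _ hx
    cases b <;> simp_all [LitVal, Lit.compl]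
  · rintro ⟨v, b⟩ hx hx'
    cases b <;> simp_all [LitVal, Lit.compl]

section

variable {F : Finset (Finset Lit)}

lemma mem_litsOf {x : Lit} : x ∈ litsOf F ↔ ∃ C ∈ F, x ∈ C ∨ x.compl ∈ C := by
  simp only [litsOf, varsOf, Finset.mem_product, Finset.mem_biUnion, Finset.mem_image,
    Finset.mem_univ, and_true]
  constructor
  · rintro ⟨C, hC, y, hy, hyx⟩
    rcases Lit.eq_or_eq_compl hyx with rfl | rfl
    exacts [⟨C, hC, .inl hy⟩, ⟨C, hC, .inr hy⟩]
  · rintro ⟨C, hC, h | h⟩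
    exacts [⟨C, hC, _, h, rfl⟩, ⟨C, hC, _, h, rfl⟩]

lemma mem_litsOf_of_mem {x : Lit} {C : Finset Lit} (hC : C ∈ F) (hx : x ∈ C) : x ∈ litsOf F :=
  mem_litsOf.2 ⟨C, hC, .inl hx⟩

/-- A minimally unsatisfiable clause-set has no non-trivial autarky. -/
lemma MU.no_autarky (hF : MU F) {T : Set Lit} (hT : Consistent T)
    (hclosed : ∀ C ∈ F, ∀ x ∈ C, x.compl ∈ T → ∃ y ∈ C, y ∈ T)
    (hne : ∃ C ∈ F, ∃ x ∈ C, x ∈ T) : False := by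
  classical
  obtain ⟨C₀, hC₀, x₀, hx₀, hx₀T⟩ := hne
  obtain ⟨ψ, hψ⟩ := hF.2.2 (F.filter fun C => ∀ x ∈ C, x ∉ T)
    ((Finset.filter_ssubset).2 ⟨C₀, hC₀, fun h => h x₀ hx₀ hx₀T⟩)
  obtain ⟨φ, hφ, hφψ⟩ := hT.exists_extend ψ
  refine hF.2.1 ⟨φ, fun C hC => ?_⟩
  by_cases h : ∃ x ∈ C, x ∈ T
  · obtain ⟨x, hx, hxT⟩ := h
    exact ⟨x, hx, hφ x hxT⟩
  · push Not at h
    obtain ⟨x, hx, hxψ⟩ := hψ C (Finset.mem_filter.2 ⟨hC, h⟩)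
    refine ⟨x, hx, (hφψ x (h x hx) fun hxT => ?_).trans hxψ⟩
    obtain ⟨y, hy, hyT⟩ := hclosed C hC x hx hxT
    exact h y hy hyT

/-- The arcs of the implication digraph. -/
def Arc (F : Finset (Finset Lit)) (a b : Lit) : Prop := insert a.compl {b} ∈ F

lemma Arc.skew {a b : Lit} (h : Arc F a b) : Arc F b.compl a.compl := by
  rw [Arc, Lit.compl_compl, Finset.pair_comm]
  exact h

lemma MU2.exists_eq_pair (hF : MU2 F) {C : Finset Lit} (hC : C ∈ F) {x : Lit} (hx : x ∈ C) :
    ∃ b, C = {x, b} := by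
  obtain ⟨D, hxD, rfl⟩ : ∃ D, x ∉ D ∧ C = insert x D :=
    ⟨C.erase x, Finset.notMem_erase _ _, (Finset.insert_erase hx).symm⟩
  have h := hF.2 _ hC
  rw [Finset.card_insert_of_notMem hxD] at h
  rcases D.eq_empty_or_nonempty with rfl | hD
  · exact ⟨x, by simp⟩
  · obtain ⟨b, rfl⟩ := Finset.card_eq_one.1 (le_antisymm (by omega) hD.card_pos)
    exact ⟨b, rfl⟩

lemma MU2.exists_arc (hF : MU2 F) {C : Finset Lit} (hC : C ∈ F) {x : Lit} (hx : x ∈ C) :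
    ∃ b, C = {x, b} ∧ Arc F x.compl b := by
  obtain ⟨b, rfl⟩ := hF.exists_eq_pair hC hx
  exact ⟨b, rfl, by rwa [Arc, Lit.compl_compl]⟩

lemma MU2.not_consistent_of_closed (hF : MU2 F) {T : Set Lit} {x : Lit} (hx : x ∈ litsOf F)
    (hxT : x ∈ T) (hclosed : ∀ p q, Arc F p q → p ∈ T → q ∈ T) : ¬ Consistent T := by
  have key : ∀ C ∈ F, ∀ x ∈ C, x.compl ∈ T → ∃ y ∈ C, y ∈ T := by
    intro C hC x hx hxT
    obtain ⟨b, rfl, hb⟩ := hF.exists_arc hC hx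
    exact ⟨b, by simp, hclosed _ _ hb hxT⟩
  intro hT
  obtain ⟨C, hC, h | h⟩ := mem_litsOf.1 hx
  · exact hF.1.no_autarky hT key ⟨C, hC, x, h, hxT⟩
  · exact hF.1.no_autarky hT key ⟨C, hC, key C hC _ h (by rwa [Lit.compl_compl])⟩

/-- The implication digraph is strongly connected. -/
lemma MU2.mem_of_closed (hF : MU2 F) {U : Set Lit} {x v : Lit} (hx : x ∈ litsOf F) (hxU : x ∈ U)
    (hv : v ∈ litsOf F) (hclosed : ∀ p q, Arc F p q → p ∈ U → q ∈ U) : v ∈ U := by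
  classical
  by_contra hvU
  have hcompl : ∀ y ∈ litsOf F, y ∈ U → y.compl ∈ U := by
    intro y hy hyU
    by_contra hyU'
    refine hF.not_consistent_of_closed (T := {z | z ∈ U ∧ z.compl ∉ U}) hy ⟨hyU, hyU'⟩ ?_
      fun z hz hz' => hz.2 hz'.1
    intro p q hpq hp
    exact ⟨hclosed _ _ hpq hp.1, fun hq => hp.2 (hclosed _ _ hpq.skew hq)⟩
  have hsub : ∀ C ∈ F, ∀ y ∈ C, y ∈ U → ∀ z ∈ C, z ∈ U := by
    intro C hC y hy hyU z hz
    have hyF := mem_litsOf_of_mem hC hy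
    obtain ⟨b, rfl, hb⟩ := hF.exists_arc hC hy
    have hbU := hclosed _ _ hb (hcompl y hyF hyU)
    rw [Finset.mem_insert, Finset.mem_singleton] at hz
    rcases hz with rfl | rfl <;> assumption
  have hcompl' : ∀ y ∈ litsOf F, y.compl ∈ U → y ∈ U := by
    intro y hy hyU
    simpa only [Lit.compl_compl] using hcompl _ (compl_mem hy) hyU
  have hmeet : ∀ y ∈ litsOf F, ∃ C ∈ F, ∃ z ∈ C, (z ∈ U ↔ y ∈ U) := by
    intro y hy
    obtain ⟨C, hC, h | h⟩ := mem_litsOf.1 hy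
    · exact ⟨C, hC, y, h, Iff.rfl⟩
    · exact ⟨C, hC, y.compl, h, hcompl' y hy, hcompl y hy⟩
  obtain ⟨Cv, hCv, zv, hzv, hzvU⟩ := hmeet v hv
  obtain ⟨Cx, hCx, zx, hzx, hzxU⟩ := hmeet x hx
  obtain ⟨ψ, hψ⟩ := hF.1.2.2 (F.filter fun C => ∀ z ∈ C, z ∈ U)
    (Finset.filter_ssubset.2 ⟨Cv, hCv, fun h => hvU (hzvU.1 (h zv hzv))⟩)
  have hψ' : ∀ C ∈ F, ∀ z ∈ C, z ∈ U → ∃ y ∈ C, y ∈ {z | z ∈ U ∧ LitVal ψ z = true} := by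
    intro C hC z hz hzU
    obtain ⟨y, hy, hyψ⟩ := hψ C (Finset.mem_filter.2 ⟨hC, hsub C hC z hz hzU⟩)
    exact ⟨y, hy, hsub C hC z hz hzU y hy, hyψ⟩
  refine hF.1.no_autarky (T := {z | z ∈ U ∧ LitVal ψ z = true}) ?_ ?_ ?_
  · intro z hz hz'
    have := hz'.2
    rw [litVal_compl, hz.2] at this
    exact absurd this (by decide)
  · intro C hC z hz hzT
    exact hψ' C hC z hz (hcompl' z (mem_litsOf_of_mem hC hz) hzT.1)
  · exact ⟨Cx, hCx, hψ' Cx hCx zx hzx (hzxU.2 hxU)⟩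

/-- Deleting a clause yields a directed cut of the implication digraph. -/
lemma MU2.exists_cut (hF : MU2 F) {a b : Lit} (hab : Arc F a b) :
    ∃ T : Set Lit, (∀ v, v.compl ∈ T ↔ v ∉ T) ∧ a ∈ T ∧ b ∉ T ∧
      ∀ p q, Arc F p q → p ∈ T → q ∉ T → (p = a ∧ q = b) ∨ (p = b.compl ∧ q = a.compl) := by
  obtain ⟨φ, hφ⟩ := hF.1.2.2 _ (Finset.erase_ssubset hab)
  have hC : ∀ y ∈ ({a.compl, b} : Finset Lit), LitVal φ y = false := by
    intro y hy
    by_contra hy'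
    refine hF.1.2.1 ⟨φ, fun C hC => ?_⟩
    by_cases h : C = {a.compl, b}
    · exact ⟨y, h ▸ hy, by simpa using hy'⟩
    · exact hφ C (Finset.mem_erase.2 ⟨h, hC⟩)
  refine ⟨{x | LitVal φ x = true}, fun v => ?_, ?_, ?_, ?_⟩
  · simp [litVal_compl]
  · simpa [litVal_compl] using hC a.compl (by simp)
  · simpa using hC b (by simp)
  · intro p q hpq hp hq
    have : ({p.compl, q} : Finset Lit) = {a.compl, b} := by
      by_contra h
      obtain ⟨y, hy, hyφ⟩ := hφ _ (Finset.mem_erase.2 ⟨h, hpq⟩)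
      rw [Finset.mem_insert, Finset.mem_singleton] at hy
      rcases hy with rfl | rfl
      · rw [litVal_compl, show LitVal φ p = true from hp] at hyφ
        exact absurd hyφ (by decide)
      · exact hq hyφ
    have h1 : p.compl ∈ ({a.compl, b} : Finset Lit) := this ▸ by simp
    have h2 : q ∈ ({a.compl, b} : Finset Lit) := this ▸ by simp
    have h3 : a.compl ∈ ({p.compl, q} : Finset Lit) := this ▸ by simp
    have h4 : b ∈ ({p.compl, q} : Finset Lit) := this ▸ by simp
    have := Lit.compl_compl
    have := Lit.compl_injective.eq_iff (a := p) (b := a)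
    simp only [Finset.mem_insert, Finset.mem_singleton] at h1 h2 h3 h4
    grind

/-- The forced literals of a unit-clause show that the deficiency is at most one. -/
lemma MU2.singleton_notMem (hF : MU2 F) (hd : 2 ≤ deficiency F) (y : Lit) : {y} ∉ F := by
  classical
  intro hy
  have hyF : y ∈ litsOf F := mem_litsOf_of_mem hy (by simp)
  let P : Finset Lit → Prop := fun W => y ∈ W ∧ Consistent W ∧ ∃ S ⊆ F, S.card ≤ W.card ∧
    ∀ φ, (∀ C ∈ S, ∃ x ∈ C, LitVal φ x = true) → ∀ x ∈ W, LitVal φ x = true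
  have hyS : ∀ φ, (∀ C ∈ ({{y}} : Finset (Finset Lit)), ∃ x ∈ C, LitVal φ x = true) →
      ∀ x ∈ ({y} : Finset Lit), LitVal φ x = true := by
    intro φ hφ
    obtain ⟨z, hz, h⟩ := hφ {y} (by simp)
    rw [Finset.mem_singleton] at hz
    simpa [hz] using h
  obtain ⟨W, hW, hmax⟩ := Finset.exists_max_image ((litsOf F).powerset.filter P) Finset.card
    ⟨{y}, Finset.mem_filter.2 ⟨by simpa using hyF, by simp, by simp [Consistent, Lit.compl_ne],
      {{y}}, by simpa using hy, by simp, hyS⟩⟩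
  obtain ⟨hWF, hyW, hWc, S, hSF, hSW, hS⟩ := Finset.mem_filter.1 hW
  rw [Finset.mem_powerset] at hWF
  have hcard : W.card ≤ (varsOf F).card := by
    refine Finset.card_le_card_of_injOn Prod.fst
      (fun x hx => (Finset.mem_product.1 (hWF hx)).1) fun x hx z hz hxz => ?_
    rcases Lit.eq_or_eq_compl hxz with h | h
    · exact h
    · exact absurd (h ▸ hx) (hWc z hz)
  obtain ⟨p, r, hpr, hp, hr⟩ : ∃ p r, Arc F p r ∧ p ∈ W ∧ r ∉ W := by
    by_contra! h
    exact hF.not_consistent_of_closed (T := W) hyF hyW h hWc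
  have hS' : ∀ φ, (∀ C ∈ insert {p.compl, r} S, ∃ x ∈ C, LitVal φ x = true) →
      (∀ x ∈ W, LitVal φ x = true) ∧ LitVal φ r = true := by
    intro φ hφ
    have h := hS φ fun C hC => hφ C (Finset.mem_insert_of_mem hC)
    obtain ⟨x, hx, hxφ⟩ := hφ _ (Finset.mem_insert_self _ _)
    rw [Finset.mem_insert, Finset.mem_singleton] at hx
    rcases hx with rfl | rfl
    · rw [litVal_compl, h p hp] at hxφ
      exact absurd hxφ (by decide)
    · exact ⟨h, hxφ⟩
  have hSF' : insert {p.compl, r} S ⊆ F := Finset.insert_subset hpr hSF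
  have hcard' := Finset.card_insert_le {p.compl, r} S
  by_cases hr' : r.compl ∈ W
  · have hunsat : ¬ Sat (insert {p.compl, r} S) := by
      rintro ⟨φ, hφ⟩
      have h1 := (hS' φ hφ).1 _ hr'
      rw [litVal_compl, (hS' φ hφ).2] at h1
      exact absurd h1 (by decide)
    have hFS : insert {p.compl, r} S = F := by
      by_contra h
      exact hunsat (hF.1.2.2 _ (Finset.ssubset_iff_subset_ne.2 ⟨hSF', h⟩))
    rw [hFS] at hcard'
    unfold deficiency at hd
    omega
  · have hWr := Finset.card_insert_of_notMem hr
    have := hmax (insert r W) (Finset.mem_filter.2 ⟨Finset.mem_powerset.2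
      (Finset.insert_subset (mem_litsOf_of_mem hpr (by simp)) hWF), by simp [hyW], ?_,
      insert {p.compl, r} S, hSF', by omega, ?_⟩)
    · omega
    · intro x hx hx'
      have := hWc x
      have := Lit.compl_ne r
      have := Lit.compl_compl x
      simp only [Finset.coe_insert, Set.mem_insert_iff, Finset.mem_coe] at hx hx' this
      grind
    · intro φ hφ x hx
      rcases Finset.mem_insert.1 hx with rfl | hx
      exacts [(hS' φ hφ).2, (hS' φ hφ).1 x hx]

lemma MU2.card_eq_two (hF : MU2 F) (hd : 2 ≤ deficiency F) {C : Finset Lit} (hC : C ∈ F) :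
    C.card = 2 := by
  have h2 := hF.2 C hC
  have h1 : C.card ≠ 1 := by
    rw [Ne, Finset.card_eq_one]
    rintro ⟨y, rfl⟩
    exact hF.singleton_notMem hd y hC
  have h0 : C.card ≠ 0 := by
    rw [Ne, Finset.card_eq_zero]
    rintro rfl
    have hF1 : {∅} = F := by
      by_contra h
      obtain ⟨φ, hφ⟩ := hF.1.2.2 {∅}
        (Finset.ssubset_iff_subset_ne.2 ⟨by simpa using hC, h⟩)
      simpa using hφ ∅ (by simp)
    rw [← hF1, deficiency, Finset.card_singleton] at hd
    omega
  omega

/-- The implication digraph with its skew-symmetry. -/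
def MU2.digraph (hF : MU2 F) (hd : 2 ≤ deficiency F) : SkewDigraph {x // x ∈ litsOf F} where
  Adj a b := Arc F a b
  inv a := ⟨Lit.compl a.1, compl_mem a.2⟩
  inv_inv a := Subtype.ext (Lit.compl_compl a.1)
  inv_ne a := fun h => Lit.compl_ne a.1 (congrArg Subtype.val h)
  skew a b h := Arc.skew h
  no_unit a h := hF.singleton_notMem hd (Lit.compl a) (by simpa [Arc] using h)
  connected := by
    rintro U ⟨x, hx⟩ hU v
    have := hF.mem_of_closed (U := Subtype.val '' U) x.2 ⟨x, hx, rfl⟩ v.2 (by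
      rintro _ q hpq ⟨p, hp, rfl⟩
      exact ⟨⟨q, mem_litsOf_of_mem hpq (by simp)⟩, hU p _ hpq hp, rfl⟩)
    obtain ⟨w, hw, hwv⟩ := this
    exact Subtype.ext hwv ▸ hw
  exists_cut a b hab := by
    obtain ⟨T, h1, h2, h3, h4⟩ := hF.exists_cut hab
    refine ⟨Subtype.val ⁻¹' T, fun v => h1 v, h2, h3, fun p q hpq hp hq => ?_⟩
    exact (h4 p q hpq hp hq).imp (fun h => ⟨Subtype.ext h.1, Subtype.ext h.2⟩)
      fun h => ⟨Subtype.ext h.1, Subtype.ext h.2⟩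

open Classical in
lemma MU2.card_filter_mem (hF : MU2 F) (hd : 2 ≤ deficiency F) (x : {x // x ∈ litsOf F}) :
    (F.filter fun C => Lit.compl x.1 ∈ C).card =
      1 + if (hF.digraph hd).Branching x then 1 else 0 := by
  have hmem : ∀ C, C ∈ F.filter (fun C => Lit.compl x.1 ∈ C) →
      ∃ b, C = {Lit.compl x.1, b.1} ∧ (hF.digraph hd).Adj x b := by
    intro C hC
    rw [Finset.mem_filter] at hC
    obtain ⟨b, rfl⟩ := hF.exists_eq_pair hC.1 hC.2
    exact ⟨⟨b, mem_litsOf_of_mem hC.1 (by simp)⟩, rfl, hC.1⟩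
  have hmem' : ∀ b, (hF.digraph hd).Adj x b →
      {Lit.compl x.1, b.1} ∈ F.filter (fun C => Lit.compl x.1 ∈ C) :=
    fun b hb => Finset.mem_filter.2 ⟨hb, by simp⟩
  split_ifs with h
  · obtain ⟨d, d', hne, hd1, hd2⟩ := h
    rw [Finset.card_eq_two]
    refine ⟨{Lit.compl x.1, d.1}, {Lit.compl x.1, d'.1}, fun h => hne ?_, ?_⟩
    · have h1 := hF.card_eq_two hd hd1
      have h2 : d.1 ∈ ({Lit.compl x.1, d'.1} : Finset Lit) := h ▸ by simp
      rw [Finset.mem_insert, Finset.mem_singleton] at h2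
      refine Subtype.ext (h2.resolve_left fun h3 => ?_)
      simp [h3] at h1
    · ext C
      rw [Finset.mem_insert, Finset.mem_singleton]
      constructor
      · intro hC
        obtain ⟨b, rfl, hb⟩ := hmem C hC
        rcases SkewDigraph.eq_or_eq_of_adj hd1 hd2 hb hne with rfl | rfl
        exacts [.inl rfl, .inr rfl]
      · rintro (rfl | rfl)
        exacts [hmem' d hd1, hmem' d' hd2]
  · obtain ⟨d, hd1⟩ := SkewDigraph.exists_adj (D := hF.digraph hd) x
    rw [add_zero, Finset.card_eq_one]
    refine ⟨_, Finset.eq_singleton_iff_unique_mem.2 ⟨hmem' d hd1, fun C hC => ?_⟩⟩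
    obtain ⟨b, rfl, hb⟩ := hmem C hC
    rw [SkewDigraph.eq_of_not_branching h hb hd1]

/-- There are twice as many branching literals as the deficiency. -/
lemma MU2.card_branching (hF : MU2 F) (hd : 2 ≤ deficiency F) :
    (Nat.card {b // (hF.digraph hd).Branching b} : ℤ) = 2 * deficiency F := by
  classical
  have hcount := Finset.sum_card_bipartiteAbove_eq_sum_card_bipartiteBelow
    (s := (Finset.univ : Finset {x // x ∈ litsOf F})) (t := F)
    (fun x C => Lit.compl x.1 ∈ C)
  have hleft : ∀ x : {x // x ∈ litsOf F},
      (F.bipartiteAbove (fun (x : {x // x ∈ litsOf F}) C => Lit.compl x.1 ∈ C) x).card =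
        1 + if (hF.digraph hd).Branching x then 1 else 0 := hF.card_filter_mem hd
  have hright : ∀ C ∈ F, ((Finset.univ : Finset {x // x ∈ litsOf F}).bipartiteBelow
      (fun x C => Lit.compl x.1 ∈ C) C).card = 2 := by
    intro C hC
    rw [← hF.card_eq_two hd hC]
    refine Finset.card_nbij (fun x => Lit.compl x.1) ?_ ?_ ?_
    · intro x hx
      exact (Finset.mem_filter.1 hx).2
    · intro x _ z _ h
      exact Subtype.ext (Lit.compl_injective h)
    · intro x hx
      exact ⟨⟨x.compl, compl_mem (mem_litsOf_of_mem hC hx)⟩, by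
        simpa [Finset.bipartiteBelow, Lit.compl_compl] using hx, Lit.compl_compl x⟩
  have hlits : (litsOf F).card = (varsOf F).card * 2 := Finset.card_product _ _
  rw [Finset.sum_congr rfl fun x _ => hleft x, Finset.sum_congr rfl hright,
    Finset.sum_add_distrib, Finset.sum_boole, Finset.sum_const, Finset.sum_const,
    Finset.card_univ, Fintype.card_coe, hlits] at hcount
  rw [Nat.card_eq_fintype_card, Fintype.card_subtype, deficiency]
  simp only [smul_eq_mul, Nat.cast_id] at hcount
  omega

end

lemma CNFIsoE.isIso {F F' : Finset (Finset Lit)} {hF : MU2 F} {hF' : MU2 F'}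
    {hd : 2 ≤ deficiency F} {hd' : 2 ≤ deficiency F'}
    {e : {x // x ∈ litsOf F} ≃ {x // x ∈ litsOf F'}} (he : CNFIsoE F F' e) :
    (hF.digraph hd).IsIso (hF'.digraph hd') e := by
  intro a b
  set g : Lit → Lit := fun y => if h : y ∈ litsOf F then (e ⟨y, h⟩ : Lit) else y
  have hg : ∀ y : {x // x ∈ litsOf F}, g y = e y := fun y => dif_pos y.2
  have hgc : g (Lit.compl a.1) = Lit.compl (e a : Lit) :=
    (hg ⟨_, compl_mem a.2⟩).trans (he.1 a)
  have himg : Finset.image g {Lit.compl a.1, b.1} = {Lit.compl (e a : Lit), (e b : Lit)} := by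
    rw [Finset.image_insert, Finset.image_singleton, hgc, hg]
  have hinj : Set.InjOn g (litsOf F) := by
    intro x hx z hz h
    rw [hg ⟨x, hx⟩, hg ⟨z, hz⟩] at h
    exact congrArg Subtype.val (e.injective (Subtype.ext h))
  change {Lit.compl a.1, b.1} ∈ F ↔ {Lit.compl (e a : Lit), (e b : Lit)} ∈ F'
  rw [← himg, ← he.2, Finset.mem_image]
  refine ⟨fun h => ⟨_, h, rfl⟩, fun ⟨C, hC, h⟩ => ?_⟩
  have hsub : (C : Set Lit) ⊆ litsOf F := fun x hx => mem_litsOf_of_mem hC hx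
  have hsub' : (({Lit.compl a.1, b.1} : Finset Lit) : Set Lit) ⊆ litsOf F := by
    intro x hx
    rw [Finset.mem_coe, Finset.mem_insert, Finset.mem_singleton] at hx
    rcases hx with rfl | rfl
    exacts [compl_mem a.2, b.2]
  have h' := congrArg (fun C : Finset Lit => (C : Set Lit)) h
  simp only [Finset.coe_image] at h'
  rwa [← Finset.coe_injective ((hinj.image_eq_image_iff hsub hsub').1 h')]

theorem stmt11 (k : ℕ) (hk : 2 ≤ k) (F F' : Finset (Finset Lit)) (hF : MU2 F) (hF' : MU2 F')
    (hdF : deficiency F = (k : ℤ)) (hdF' : deficiency F' = (k : ℤ)) :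
    Nat.card {e : {x // x ∈ litsOf F} ≃ {x // x ∈ litsOf F'} // CNFIsoE F F' e} ≤ 4 * k ∧
    ∃ φ : {π : Equiv.Perm {x // x ∈ litsOf F} // CNFIsoE F F π} → DihedralGroup (2 * k),
      Function.Injective φ ∧
      ∀ (a b : {π : Equiv.Perm {x // x ∈ litsOf F} // CNFIsoE F F π})
        (hab : CNFIsoE F F (a.1 * b.1)), φ ⟨a.1 * b.1, hab⟩ = φ a * φ b := by
  have hd : 2 ≤ deficiency F := by omega
  have hd' : 2 ≤ deficiency F' := by omega
  have hn : 3 ≤ 2 * k := by omega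
  have hB : Nat.card {b // (hF.digraph hd).Branching b} = 2 * k := by
    have := hF.card_branching hd
    omega
  have hB' : Nat.card {b // (hF'.digraph hd').Branching b} = 2 * k := by
    have := hF'.card_branching hd'
    omega
  have : NeZero (2 * k) := ⟨by omega⟩
  constructor
  · obtain ⟨φ, hφ⟩ := SkewDigraph.exists_embedding_dihedral hn hB hB'
    have h := Nat.card_le_card_of_injective (fun e : {e // CNFIsoE F F' e} => φ ⟨e.1, e.2.isIso⟩)
      fun e e' h => Subtype.ext (congrArg (fun e => e.1) (hφ h))
    rw [DihedralGroup.nat_card] at h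
    omega
  · obtain ⟨φ, hφ, hmul⟩ := SkewDigraph.exists_hom_dihedral hn hB
    exact ⟨fun π => φ ⟨π.1, π.2.isIso⟩,
      fun π π' h => Subtype.ext (congrArg (fun π => π.1) (hφ h)),
      fun a b hab => hmul ⟨a.1, a.2.isIso⟩ ⟨b.1, b.2.isIso⟩ hab.isIso⟩
end

section
/- For every m ≥ 3 and every m-weak-double-cycle G, the automorphism group of G (digraph isomorphisms from G to itself under composition) is isomorphic to a subgroup of the dihedral group with 2m elements. -/
/-- The branching structure of a weak double-cycle: `t i` are the vertices of out-degree two, and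
`τ v` is the index of the first branching vertex met when following the arcs from `v`. -/
structure Branching {α : Type} (m : ℕ) (G : FinDigraph α) (t : ZMod m → α) (τ : α → ZMod m) :
    Prop where
  wellFormed : G.WellFormed
  mem : ∀ i, t i ∈ G.V
  index : ∀ i, τ (t i) = i
  linear : ∀ v ∈ G.V, (∀ i, v ≠ t i) → ∃ w, τ w = τ v ∧ ∀ y, (v, y) ∈ G.E ↔ y = w
  branch : ∀ i, ∃ a b, τ a = i + 1 ∧ τ b = i - 1 ∧ ∀ y, (t i, y) ∈ G.E ↔ y = a ∨ y = b
  connected : StronglyConnected G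

lemma StronglyConnected.of_map {α : Type} {G G' : FinDigraph α} (h : α → α)
    (hG : StronglyConnected G)
    (harc : ∀ a b, (a, b) ∈ G.E →
      Relation.ReflTransGen (fun x y => (x, y) ∈ G'.E) (h a) (h b))
    (hV : ∀ c ∈ G'.V, ∃ a ∈ G.V, ∃ b ∈ G.V,
      Relation.ReflTransGen (fun x y => (x, y) ∈ G'.E) (h a) c ∧
      Relation.ReflTransGen (fun x y => (x, y) ∈ G'.E) c (h b)) :
    StronglyConnected G' := by
  intro c hc d hd
  obtain ⟨-, -, b, hb, -, hcb⟩ := hV c hc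
  obtain ⟨a, ha, -, -, had, -⟩ := hV d hd
  refine hcb.trans (Relation.ReflTransGen.trans ?_ had)
  exact Relation.ReflTransGen.trans_induction_on
    (motive := fun {x y} _ => Relation.ReflTransGen (fun x y => (x, y) ∈ G'.E) (h x) (h y))
    (hG b hb a ha) (fun _ => .refl) (fun hab => harc _ _ hab) (fun _ _ h₁ h₂ => h₁.trans h₂)

lemma Branching.exists_arc {α : Type} {m : ℕ} {G : FinDigraph α} {t : ZMod m → α}
    {τ : α → ZMod m} (h : Branching m G t τ) {v : α} (hv : v ∈ G.V) : ∃ w, (v, w) ∈ G.E := by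
  by_cases hvt : ∀ i, v ≠ t i
  · obtain ⟨w, -, hw⟩ := h.linear v hv hvt
    exact ⟨w, (hw w).2 rfl⟩
  · push Not at hvt
    obtain ⟨i, rfl⟩ := hvt
    obtain ⟨a, b, -, -, hab⟩ := h.branch i
    exact ⟨a, (hab a).2 (.inl rfl)⟩

lemma Branching.splitArc {α : Type} [DecidableEq α] {m : ℕ} {G G' : FinDigraph α}
    {t : ZMod m → α} {τ : α → ZMod m} (h : Branching m G t τ) (hs : SplitArc G G') :
    ∃ t' τ', Branching m G' t' τ' := by
  obtain ⟨x, y, v, hxy, hv, hV, hE⟩ := hs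
  have wf : ∀ a b, (a, b) ∈ G.E → a ∈ G.V ∧ b ∈ G.V ∧ a ≠ b := fun a b => h.wellFormed (a, b)
  have memE : ∀ a b, (a, b) ∈ G'.E ↔
      (a = x ∧ b = v) ∨ (a = v ∧ b = y) ∨ (¬(a = x ∧ b = y) ∧ (a, b) ∈ G.E) := by
    intro a b; simp [hE]
  have memV : ∀ a, a ∈ G'.V ↔ a = v ∨ a ∈ G.V := by intro a; simp [hV]
  refine ⟨t, fun z => if z = v then τ y else τ z, ?_, ?_, ?_, ?_, ?_, ?_⟩
  · rintro ⟨a, b⟩ hab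
    grind
  · intro i; exact (memV _).2 (.inr (h.mem i))
  · intro i
    have := h.mem i
    have := h.index i
    grind
  · intro w hw hwt
    by_cases hwv : w = v
    · exact ⟨y, by grind, by grind⟩
    · have hw' : w ∈ G.V := by grind
      obtain ⟨z, hz, hzE⟩ := h.linear w hw' hwt
      have := wf _ _ ((hzE z).2 rfl)
      by_cases hwx : w = x
      · exact ⟨v, by grind, by grind⟩
      · exact ⟨z, by grind, by grind⟩
  · intro i
    obtain ⟨a, b, ha, hb, hab⟩ := h.branch i
    have hi := h.mem i
    have hia := wf _ _ ((hab a).2 (.inl rfl))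
    have hib := wf _ _ ((hab b).2 (.inr rfl))
    by_cases hix : t i = x
    · refine ⟨if a = y then v else a, if b = y then v else b, ?_, ?_, ?_⟩
      · grind
      · grind
      · grind
    · exact ⟨a, b, by grind, by grind, by grind⟩
  · have hxv : (x, v) ∈ G'.E := (memE _ _).2 (by grind)
    have hvy : (v, y) ∈ G'.E := (memE _ _).2 (by grind)
    refine h.connected.of_map id ?_ ?_
    · intro a b hab
      by_cases hc : a = x ∧ b = y
      · obtain ⟨rfl, rfl⟩ := hc
        exact .head hxv (.single hvy)
      · exact .single ((memE _ _).2 (by grind))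
    · intro c hc
      by_cases hcv : c = v
      · subst hcv
        exact ⟨x, (wf _ _ hxy).1, y, (wf _ _ hxy).2.1, .single hxv, .single hvy⟩
      · have : c ∈ G.V := by grind
        exact ⟨c, this, c, this, .refl, .refl⟩

lemma Branching.splitVertex {α : Type} [DecidableEq α] {m : ℕ} {G G' : FinDigraph α}
    {t : ZMod m → α} {τ : α → ZMod m} (h : Branching m G t τ) (hs : SplitVertex G G') :
    ∃ t' τ', Branching m G' t' τ' := by
  obtain ⟨x, u, v, hx, hu, hv, huv, hV, hE⟩ := hs
  have wf : ∀ a b, (a, b) ∈ G.E → a ∈ G.V ∧ b ∈ G.V ∧ a ≠ b := fun a b => h.wellFormed (a, b)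
  have memE : ∀ a b, (a, b) ∈ G'.E ↔ (a = u ∧ b = v) ∨ (a ≠ x ∧ b ≠ x ∧ (a, b) ∈ G.E) ∨
      (b = u ∧ (a, x) ∈ G.E) ∨ (a = v ∧ (x, b) ∈ G.E) := by
    intro a b
    simp only [hE, Finset.mem_insert, Finset.mem_union, Finset.mem_filter, Finset.mem_image,
      Prod.exists, Prod.mk.injEq]
    grind
  have memV : ∀ a, a ∈ G'.V ↔ a = u ∨ a = v ∨ (a ≠ x ∧ a ∈ G.V) := by intro a; simp [hV]
  have hux : u ≠ x := by grind
  have hvx : v ≠ x := by grind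
  refine ⟨fun i => if t i = x then v else t i, fun z => if z = u ∨ z = v then τ x else τ z,
    ?_, ?_, ?_, ?_, ?_, ?_⟩
  · rintro ⟨a, b⟩ hab
    grind
  · intro i
    have := h.mem i
    grind
  · intro i
    have := h.mem i
    have := h.index i
    grind
  · intro w hw hwt
    by_cases hwu : w = u
    · exact ⟨v, by grind, by grind⟩
    by_cases hwv : w = v
    · obtain ⟨z, hz, hzE⟩ := h.linear x hx (by grind)
      have := wf _ _ ((hzE z).2 rfl)
      exact ⟨z, by grind, by grind⟩
    · have hw' : w ∈ G.V := by grind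
      obtain ⟨z, hz, hzE⟩ := h.linear w hw' (by grind)
      have := wf _ _ ((hzE z).2 rfl)
      exact ⟨if z = x then u else z, by grind, by grind⟩
  · intro i
    obtain ⟨a, b, ha, hb, hab⟩ := h.branch i
    have hi := h.mem i
    have hia := wf _ _ ((hab a).2 (.inl rfl))
    have hib := wf _ _ ((hab b).2 (.inr rfl))
    by_cases hix : t i = x
    · exact ⟨a, b, by grind, by grind, by grind⟩
    · exact ⟨if a = x then u else a, if b = x then u else b, by grind, by grind, by grind⟩
  · have huvE : (u, v) ∈ G'.E := (memE _ _).2 (by grind)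
    refine h.connected.of_map (fun z => if z = x then u else z) ?_ ?_
    · intro a b hab
      have := wf _ _ hab
      by_cases hax : a = x
      · have hvb : (v, b) ∈ G'.E := (memE _ _).2 (by grind)
        have hbx : b ≠ x := by grind
        simpa [hax, hbx] using Relation.ReflTransGen.head huvE (.single hvb)
      · refine .single ((memE _ _).2 ?_)
        grind
    · intro c hc
      by_cases hcv : c = v
      · obtain ⟨y, hy⟩ := h.exists_arc hx
        have := wf _ _ hy
        have hvy : (v, y) ∈ G'.E := (memE _ _).2 (by grind)
        have hyx : y ≠ x := by grind
        refine ⟨x, hx, y, this.2.1, ?_, ?_⟩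
        · simpa [hcv] using Relation.ReflTransGen.single huvE
        · simpa [hcv, hyx] using Relation.ReflTransGen.single hvy
      · by_cases hcu : c = u
        · exact ⟨x, hx, x, hx, by simp [hcu, Relation.ReflTransGen.refl],
            by simp [hcu, Relation.ReflTransGen.refl]⟩
        · have hcx : c ≠ x := by grind
          have hcV : c ∈ G.V := by grind
          exact ⟨c, hcV, c, hcV, by simp [hcx, Relation.ReflTransGen.refl],
            by simp [hcx, Relation.ReflTransGen.refl]⟩

lemma mem_stdDoubleCycle_E {m a b : ℕ} : (a, b) ∈ (stdDoubleCycle m).E ↔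
    a < m ∧ b < m ∧ ((b : ZMod m) = a + 1 ∨ (b : ZMod m) = a - 1) := by
  simp only [stdDoubleCycle, Finset.mem_biUnion, Finset.mem_range, Finset.mem_insert,
    Finset.mem_singleton, Prod.mk.injEq]
  have key : ∀ i j : ℕ, j < m → ((j : ZMod m) = i + 1 ↔ j = (i + 1) % m) := by
    intro i j hj
    have := ZMod.natCast_eq_natCast_iff' j (i + 1) m
    rw [Nat.mod_eq_of_lt hj] at this
    exact_mod_cast this
  constructor
  · rintro ⟨i, hi, ⟨rfl, rfl⟩ | ⟨rfl, rfl⟩⟩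
    · exact ⟨hi, Nat.mod_lt _ (by omega), by simp⟩
    · exact ⟨Nat.mod_lt _ (by omega), hi, by simp⟩
  · rintro ⟨ha, hb, h | h⟩
    · exact ⟨a, ha, .inl ⟨rfl, (key a b hb).1 h⟩⟩
    · exact ⟨b, hb, .inr ⟨(key b a ha).1 (by rw [h]; ring), rfl⟩⟩

lemma ZMod.two_ne_zero_of_three_le {m : ℕ} (hm : 3 ≤ m) : (2 : ZMod m) ≠ 0 := by
  intro h
  have : ((2 : ℕ) : ZMod m) = 0 := by exact_mod_cast h
  rw [ZMod.natCast_eq_zero_iff] at this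
  exact absurd (Nat.le_of_dvd (by norm_num) this) (by omega)

lemma IsDoubleCycle.exists_branching {α : Type} [DecidableEq α] {m : ℕ} {G : FinDigraph α}
    (hG : IsDoubleCycle m G) : ∃ t τ, Branching m G t τ := by
  obtain ⟨hm, f, hf, hE⟩ := hG
  have : NeZero m := ⟨by omega⟩
  have : Fact (1 < m) := ⟨by omega⟩
  have hV : ((stdDoubleCycle m).V : Set ℕ) = Set.Iio m := by ext; simp [stdDoubleCycle]
  rw [hV] at hf
  set t : ZMod m → α := fun i => f i.val with ht
  have tinj : Function.Injective t := fun i j hij =>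
    ZMod.val_injective m (hf.injOn (ZMod.val_lt i) (ZMod.val_lt j) hij)
  have tmem : ∀ i, t i ∈ G.V := fun i => hf.mapsTo (ZMod.val_lt i)
  have tsurj : ∀ v ∈ G.V, ∃ i, t i = v := by
    intro v hv
    obtain ⟨k, hk, rfl⟩ := hf.surjOn hv
    exact ⟨k, by simp [ht, ZMod.val_natCast_of_lt hk]⟩
  have hτ : ∀ i, Function.invFun t (t i) = i := Function.leftInverse_invFun tinj
  have memE : ∀ x y, (x, y) ∈ G.E ↔ ∃ i j, t i = x ∧ t j = y ∧ (j = i + 1 ∨ j = i - 1) := by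
    intro x y
    rw [← hE]
    simp only [Finset.mem_image, Prod.exists, mem_stdDoubleCycle_E, Prod.mk.injEq]
    constructor
    · rintro ⟨a, b, ⟨ha, hb, hab⟩, rfl, rfl⟩
      exact ⟨a, b, by simp [ht, ZMod.val_natCast_of_lt ha],
        by simp [ht, ZMod.val_natCast_of_lt hb], hab⟩
    · rintro ⟨i, j, rfl, rfl, hij⟩
      exact ⟨i.val, j.val, ⟨ZMod.val_lt i, ZMod.val_lt j, by simpa using hij⟩, rfl, rfl⟩
  refine ⟨t, Function.invFun t, ?_, tmem, hτ, ?_, ?_, ?_⟩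
  · rintro ⟨x, y⟩ hxy
    obtain ⟨i, j, rfl, rfl, hij⟩ := (memE x y).1 hxy
    refine ⟨tmem i, tmem j, fun hxy => ?_⟩
    have := tinj hxy
    subst this
    have hij : i = i - 1 := by simpa using hij
    exact one_ne_zero (α := ZMod m) (by linear_combination hij)
  · intro v hv hvt
    obtain ⟨i, rfl⟩ := tsurj v hv
    exact absurd rfl (hvt i)
  · intro i
    refine ⟨t (i + 1), t (i - 1), hτ _, hτ _, fun y => ?_⟩
    rw [memE]
    constructor
    · rintro ⟨i', j, hi, rfl, hij⟩
      obtain rfl := tinj hi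
      exact hij.imp (congrArg t) (congrArg t)
    · rintro (rfl | rfl)
      · exact ⟨i, _, rfl, rfl, .inl rfl⟩
      · exact ⟨i, _, rfl, rfl, .inr rfl⟩
  · intro a ha b hb
    obtain ⟨i, rfl⟩ := tsurj a ha
    obtain ⟨j, rfl⟩ := tsurj b hb
    have step : ∀ k : ℕ,
        Relation.ReflTransGen (fun x y => (x, y) ∈ G.E) (t i) (t (i + k)) := by
      intro k
      induction k with
      | zero => simp [Relation.ReflTransGen.refl]
      | succ k ih =>
        exact ih.tail ((memE _ _).2 ⟨_, _, rfl, rfl, .inl (by push_cast; ring)⟩)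
    simpa using step (j - i).val

lemma IsWDC.exists_branching {α : Type} [DecidableEq α] {m : ℕ} {G : FinDigraph α}
    (hG : IsWDC m G) : ∃ t τ, Branching m G t τ := by
  obtain ⟨G₀, h₀, hsplit⟩ := hG
  induction hsplit with
  | refl => exact h₀.exists_branching
  | tail _ hs ih =>
    obtain ⟨t, τ, h⟩ := ih
    exact hs.elim h.splitVertex h.splitArc

/-- The action of the dihedral group on the vertices of the `m`-gon. -/
def DihedralGroup.vertexAct {m : ℕ} : DihedralGroup m → ZMod m → ZMod m
  | .r c, x => x + c
  | .sr c, x => -x - c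

lemma DihedralGroup.vertexAct_mul {m : ℕ} (a b : DihedralGroup m) (x : ZMod m) :
    (a * b).vertexAct x = a.vertexAct (b.vertexAct x) := by
  cases a <;> cases b <;> simp [vertexAct] <;> ring

lemma DihedralGroup.vertexAct_injective {m : ℕ} (hm : 3 ≤ m) :
    Function.Injective (vertexAct (m := m)) := by
  have h2 := ZMod.two_ne_zero_of_three_le hm
  rintro (c | c) (d | d) h
  · simpa [vertexAct] using congrFun h 0
  · have h0 := congrFun h 0
    have h1 := congrFun h 1
    simp only [vertexAct] at h0 h1
    exact absurd (by linear_combination h1 - h0) h2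
  · have h0 := congrFun h 0
    have h1 := congrFun h 1
    simp only [vertexAct] at h0 h1
    exact absurd (by linear_combination h0 - h1) h2
  · simpa [vertexAct] using congrFun h 0

lemma DihedralGroup.exists_vertexAct_eq {m : ℕ} (hm : 3 ≤ m) {g : ZMod m → ZMod m}
    (hg : Function.Injective g) (hadj : ∀ i, g (i + 1) = g i + 1 ∨ g (i + 1) = g i - 1) :
    ∃ d : DihedralGroup m, d.vertexAct = g := by
  have : NeZero m := ⟨by omega⟩
  have h2 := ZMod.two_ne_zero_of_three_le hm
  have hne : ∀ i, g (i + 1 + 1) ≠ g i := fun i hi => h2 (by linear_combination hg hi)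
  have affine : ∀ s : ZMod m, (s = 1 ∨ s = -1) → g 1 = g 0 + s → ∀ i, g i = g 0 + s * i := by
    intro s hs h1
    have main : ∀ k : ℕ, g k = g 0 + s * k ∧ g (k + 1) = g k + s := by
      intro k
      induction k with
      | zero => simpa using h1
      | succ k ih =>
        have hk := hadj (k + 1)
        have hk' := hne k
        push_cast
        refine ⟨by rw [ih.2, ih.1]; ring, ?_⟩
        rcases hs with rfl | rfl
        · refine hk.resolve_right fun hc => hk' ?_
          rw [hc, ih.2]; ring
        · refine (hk.resolve_left fun hc => hk' ?_).trans (by ring)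
          rw [hc, ih.2]; ring
    intro i
    simpa using (main i.val).1
  rcases (by simpa using hadj 0 : g 1 = g 0 + 1 ∨ g 1 = g 0 - 1) with h | h
  · refine ⟨.r (g 0), funext fun i => ?_⟩
    rw [affine 1 (.inl rfl) h i, vertexAct]; ring
  · refine ⟨.sr (-g 0), funext fun i => ?_⟩
    rw [affine (-1) (.inr rfl) (by rw [h]; ring) i, vertexAct]; ring

section Automorphisms

variable {α : Type} {m : ℕ} {G : FinDigraph α} {t : ZMod m → α} {τ : α → ZMod m}

lemma Branching.mem_range_of_two_arcs (h : Branching m G t τ) {v a b : α}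
    (ha : (v, a) ∈ G.E) (hb : (v, b) ∈ G.E) (hab : a ≠ b) : ∃ i, t i = v := by
  by_contra! hv
  obtain ⟨w, -, hw⟩ := h.linear v (h.wellFormed _ ha).1 fun i => (hv i).symm
  exact hab (((hw a).1 ha).trans ((hw b).1 hb).symm)

lemma Branching.exists_index_map (hm : 3 ≤ m) (h : Branching m G t τ)
    {π : Equiv.Perm {x // x ∈ G.V}} (hπ : FinDigraphAut G π) (i : ZMod m) :
    ∃ j, t j = π ⟨t i, h.mem i⟩ := by
  obtain ⟨a, b, ha, hb, hab⟩ := h.branch i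
  have haE := (hab a).2 (.inl rfl)
  have hbE := (hab b).2 (.inr rfl)
  have hne : a ≠ b := by
    rintro rfl
    exact ZMod.two_ne_zero_of_three_le hm (by linear_combination hb - ha)
  have haV := (h.wellFormed _ haE).2.1
  have hbV := (h.wellFormed _ hbE).2.1
  refine h.mem_range_of_two_arcs ((hπ ⟨_, h.mem i⟩ ⟨a, haV⟩).1 haE)
    ((hπ ⟨_, h.mem i⟩ ⟨b, hbV⟩).1 hbE) fun hc => hne ?_
  exact congrArg Subtype.val (π.injective (Subtype.ext hc))

/-- Going along an arc from a nonbranching vertex does not change the index. -/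
lemma Branching.index_arc (h : Branching m G t τ) {v w : α} (hv : ∀ i, v ≠ t i)
    (hvw : (v, w) ∈ G.E) : τ w = τ v := by
  obtain ⟨z, hz, hzE⟩ := h.linear v (h.wellFormed _ hvw).1 hv
  rw [(hzE w).1 hvw, hz]

lemma Branching.index_map (hm : 3 ≤ m) (h : Branching m G t τ)
    {π : Equiv.Perm {x // x ∈ G.V}} (hπ : FinDigraphAut G π) {g : ZMod m → ZMod m}
    (hg : ∀ i, t (g i) = π ⟨t i, h.mem i⟩) (v : {x // x ∈ G.V}) :
    τ (π v) = g (τ v) := by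
  have branching : ∀ i (hv : t i ∈ G.V), τ (π ⟨t i, hv⟩) = g (τ (t i)) := by
    intro i hv
    rw [← hg, h.index, h.index]
  have hπinv : FinDigraphAut G π⁻¹ := by
    intro a b
    simpa using (hπ (π⁻¹ a) (π⁻¹ b)).symm
  suffices ∀ w, Relation.ReflTransGen (fun x y => (x, y) ∈ G.E) w (t 0) →
      ∀ hw : w ∈ G.V, τ (π ⟨w, hw⟩) = g (τ w) from
    this v (h.connected _ v.2 _ (h.mem 0)) v.2
  intro w hw
  induction hw using Relation.ReflTransGen.head_induction_on with
  | refl => exact branching 0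
  | @head a b hab _ ih =>
    intro ha
    by_cases hat : ∀ i, a ≠ t i
    · have hbV := (h.wellFormed _ hab).2.1
      have hπat : ∀ i, (π ⟨a, ha⟩ : α) ≠ t i := by
        intro i hi
        obtain ⟨j, hj⟩ := h.exists_index_map hm hπinv i
        refine hat j ?_
        have hi' : π ⟨a, ha⟩ = ⟨t i, h.mem i⟩ := Subtype.ext hi
        rw [hj, ← hi']
        simp
      rw [← h.index_arc hat hab, ← ih hbV]
      exact (h.index_arc hπat ((hπ ⟨a, ha⟩ ⟨b, hbV⟩).1 hab)).symm
    · push Not at hat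
      obtain ⟨i, rfl⟩ := hat
      exact branching i ha

lemma Branching.index_adj (h : Branching m G t τ) {i : ZMod m} {w : α} (hw : (t i, w) ∈ G.E) :
    τ w = i + 1 ∨ τ w = i - 1 := by
  obtain ⟨a, b, ha, hb, hab⟩ := h.branch i
  rcases (hab w).1 hw with rfl | rfl
  · exact .inl ha
  · exact .inr hb

lemma Branching.exists_dihedral (hm : 3 ≤ m) (h : Branching m G t τ)
    {π : Equiv.Perm {x // x ∈ G.V}} (hπ : FinDigraphAut G π) :
    ∃ d : DihedralGroup m, ∀ i, t (d.vertexAct i) = π ⟨t i, h.mem i⟩ := by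
  choose g hg using h.exists_index_map hm hπ
  have tinj : Function.Injective t := Function.LeftInverse.injective h.index
  have ginj : Function.Injective g := by
    intro i j hij
    have hc := (hg i).symm.trans ((congrArg t hij).trans (hg j))
    exact tinj (congrArg Subtype.val (π.injective (Subtype.ext hc)))
  have gadj : ∀ i, g (i + 1) = g i + 1 ∨ g (i + 1) = g i - 1 := by
    intro i
    obtain ⟨a, b, ha, -, hab⟩ := h.branch i
    have haE := (hab a).2 (.inl rfl)
    have haV := (h.wellFormed _ haE).2.1
    have hE := (hπ ⟨_, h.mem i⟩ ⟨a, haV⟩).1 haE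
    rw [← hg] at hE
    have := h.index_adj hE
    rwa [h.index_map hm hπ hg, ha] at this
  obtain ⟨d, rfl⟩ := DihedralGroup.exists_vertexAct_eq hm ginj gadj
  exact ⟨d, hg⟩

lemma Branching.out_injective (hm : 3 ≤ m) (h : Branching m G t τ) {v a b : α}
    (ha : (v, a) ∈ G.E) (hb : (v, b) ∈ G.E) (hab : τ a = τ b) : a = b := by
  by_contra hne
  obtain ⟨i, rfl⟩ := h.mem_range_of_two_arcs ha hb hne
  obtain ⟨p, q, hp, hq, hpq⟩ := h.branch i
  have hτ : τ p ≠ τ q := fun hc =>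
    ZMod.two_ne_zero_of_three_le hm (by linear_combination hc - hp + hq)
  have h1 := (hpq a).1 ha
  have h2 := (hpq b).1 hb
  grind

/-- Automorphisms are determined by their effect on the branching vertices. -/
lemma Branching.aut_ext (hm : 3 ≤ m) (h : Branching m G t τ)
    {π ρ : Equiv.Perm {x // x ∈ G.V}} (hπ : FinDigraphAut G π) (hρ : FinDigraphAut G ρ)
    {g : ZMod m → ZMod m} (hgπ : ∀ i, t (g i) = π ⟨t i, h.mem i⟩)
    (hgρ : ∀ i, t (g i) = ρ ⟨t i, h.mem i⟩) : π = ρ := by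
  suffices ∀ w, Relation.ReflTransGen (fun x y => (x, y) ∈ G.E) (t 0) w →
      ∀ hw : w ∈ G.V, π ⟨w, hw⟩ = ρ ⟨w, hw⟩ from
    Equiv.ext fun v => this v (h.connected _ (h.mem 0) _ v.2) v.2
  intro w hw
  induction hw with
  | refl => exact fun _ => Subtype.ext ((hgπ 0).symm.trans (hgρ 0))
  | @tail a b _ hab ih =>
    intro hb
    have haV := (h.wellFormed _ hab).1
    have h1 := (hπ ⟨a, haV⟩ ⟨b, hb⟩).1 hab
    have h2 := (hρ ⟨a, haV⟩ ⟨b, hb⟩).1 hab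
    rw [← ih haV] at h2
    refine Subtype.ext (h.out_injective hm h1 h2 ?_)
    rw [h.index_map hm hπ hgπ, h.index_map hm hρ hgρ]

end Automorphisms

theorem stmt12 (m : ℕ) (hm : 3 ≤ m) (G : FinDigraph ℕ) (hG : IsWDC m G) :
    ∃ φ : {π : Equiv.Perm {x // x ∈ G.V} // FinDigraphAut G π} → DihedralGroup m,
      Function.Injective φ ∧
      ∀ (a b : {π : Equiv.Perm {x // x ∈ G.V} // FinDigraphAut G π})
        (hab : FinDigraphAut G (a.1 * b.1)), φ ⟨a.1 * b.1, hab⟩ = φ a * φ b := by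
  obtain ⟨t, τ, h⟩ := hG.exists_branching
  choose φ hφ using fun π : {π : Equiv.Perm {x // x ∈ G.V} // FinDigraphAut G π} =>
    h.exists_dihedral hm π.2
  refine ⟨φ, fun a b hab => ?_, fun a b hab => ?_⟩
  · refine Subtype.ext (h.aut_ext hm a.2 b.2 (hφ a) ?_)
    rw [hab]
    exact hφ b
  · refine DihedralGroup.vertexAct_injective hm (funext fun i => ?_)
    have tinj : Function.Injective t := Function.LeftInverse.injective h.index
    refine tinj ?_
    rw [hφ ⟨a.1 * b.1, hab⟩, DihedralGroup.vertexAct_mul, hφ a]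
    exact congrArg (fun z => (a.1 z : ℕ)) (Subtype.ext (hφ b i).symm)
end

section
/- For every m ≥ 3, the isomorphism classes of nonlinear m-weak-double-cycles are in bijection with the equivalence classes of binary bracelets of length m (binary strings of length m up to rotation and reflection). -/
/-- `G` is the double cycle on `ZMod m` whose vertices `i` with `b i = true` have been split:
`p i` receives the arcs into `i`, and `q i` emits the arcs out of `i`. -/
structure SplitDoubleCycle {α : Type} (m : ℕ) (b : ZMod m → Bool) (p q : ZMod m → α)
    (G : FinDigraph α) : Prop where
  inj_in : Function.Injective p
  inj_out : Function.Injective q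
  cross : ∀ i j, p i = q j → i = j ∧ b i = false
  unsplit : ∀ i, b i = false → p i = q i
  mem_V : ∀ x, x ∈ G.V ↔ ∃ i, x = p i ∨ x = q i
  mem_E : ∀ x y, (x, y) ∈ G.E ↔ ∃ i, (b i = true ∧ x = p i ∧ y = q i) ∨
    (x = q i ∧ (y = p (i + 1) ∨ y = p (i - 1)))

/-- `v` is a vertex with unique in-neighbour `a` and unique out-neighbour `c`. -/
def LinearAt {α : Type} (G : FinDigraph α) (v a c : α) : Prop :=
  v ∈ G.V ∧ (∀ y, (y, v) ∈ G.E ↔ y = a) ∧ ∀ y, (v, y) ∈ G.E ↔ y = c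

lemma ZMod.add_one_ne_sub_one {m : ℕ} (hm : 3 ≤ m) (i : ZMod m) : i + 1 ≠ i - 1 := by
  intro h
  apply ZMod.two_ne_zero_of_three_le hm
  linear_combination h

lemma FinDigraph.WellFormed.mem {α : Type} {G : FinDigraph α} (h : G.WellFormed) (y z : α)
    (hyz : (y, z) ∈ G.E) : y ∈ G.V ∧ z ∈ G.V ∧ y ≠ z := h _ hyz

section Splitting

variable {α : Type} [DecidableEq α] {G G' : FinDigraph α}

lemma LinearAt.not_nonlinear {v a c : α} (h : LinearAt G v a c) : ¬ G.Nonlinear := by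
  obtain ⟨hv, hin, hout⟩ := h
  refine fun hn => hn v hv ⟨?_, ?_⟩
  · refine Finset.card_eq_one.2 ⟨(a, v), ?_⟩
    ext ⟨x, y⟩
    simp only [Finset.mem_filter, Finset.mem_singleton, Prod.mk.injEq]
    grind
  · refine Finset.card_eq_one.2 ⟨(v, c), ?_⟩
    ext ⟨x, y⟩
    simp only [Finset.mem_filter, Finset.mem_singleton, Prod.mk.injEq]
    grind

/-- The arcs of a digraph after splitting `x` into `u`, `w`. -/
lemma mem_E_of_split {x u w : α}
    (hE : G'.E = insert (u, w)
      ((G.E.filter (fun p => p.1 ≠ x ∧ p.2 ≠ x)) ∪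
       ((G.E.filter (fun p => p.2 = x)).image (fun p => (p.1, u))) ∪
       ((G.E.filter (fun p => p.1 = x)).image (fun p => (w, p.2))))) (y z : α) :
    (y, z) ∈ G'.E ↔ (y = u ∧ z = w) ∨ ((y, z) ∈ G.E ∧ y ≠ x ∧ z ≠ x) ∨
      ((y, x) ∈ G.E ∧ z = u) ∨ ((x, z) ∈ G.E ∧ y = w) := by
  rw [hE]
  simp only [Finset.mem_insert, Finset.mem_union, Finset.mem_filter, Finset.mem_image,
    Prod.mk.injEq, Prod.exists]
  grind

lemma SplitVertex.wellFormed (h : SplitVertex G G') (hG : G.WellFormed) : G'.WellFormed := by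
  obtain ⟨x, u, w, hx, hu, hw, huw, hV, hE⟩ := h
  have hE' := mem_E_of_split hE
  rintro ⟨y, z⟩ hyz
  have := hG.mem
  rw [hE'] at hyz
  simp only [hV, Finset.mem_insert, Finset.mem_erase]
  grind

lemma SplitArc.wellFormed (h : SplitArc G G') (hG : G.WellFormed) : G'.WellFormed := by
  obtain ⟨x, y, w, hxy, hw, hV, hE⟩ := h
  rintro ⟨s, t⟩ hst
  have := hG.mem
  simp only [hE, Finset.mem_insert, Finset.mem_erase, Prod.mk.injEq] at hst
  simp only [hV, Finset.mem_insert]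
  grind

lemma SplitArc.linearAt (h : SplitArc G G') (hG : G.WellFormed) :
    ∃ v a c, LinearAt G' v a c := by
  obtain ⟨x, y, w, hxy, hw, hV, hE⟩ := h
  have := hG.mem
  refine ⟨w, x, y, ?_, ?_, ?_⟩
  · simp [hV]
  all_goals
    intro z
    simp only [hE, Finset.mem_insert, Finset.mem_erase, Prod.mk.injEq]
    grind

/-- Splitting a vertex which has a single in-neighbour or a single out-neighbour creates a
linear vertex. -/
lemma linearAt_of_split_of_unique {x u w : α} (hG : G.WellFormed)
    (hu : u ∉ G.V) (hw : w ∉ G.V) (huw : u ≠ w)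
    (hV : G'.V = insert u (insert w (G.V.erase x)))
    (hE : ∀ y z, (y, z) ∈ G'.E ↔ (y = u ∧ z = w) ∨ ((y, z) ∈ G.E ∧ y ≠ x ∧ z ≠ x) ∨
      ((y, x) ∈ G.E ∧ z = u) ∨ ((x, z) ∈ G.E ∧ y = w))
    (h : (∃ a, ∀ y, (y, x) ∈ G.E ↔ y = a) ∨ ∃ c, ∀ y, (x, y) ∈ G.E ↔ y = c) :
    ∃ v a c, LinearAt G' v a c := by
  have := hG.mem
  rcases h with ⟨a, ha⟩ | ⟨c, hc⟩
  · refine ⟨u, a, w, by simp [hV], ?_, ?_⟩ <;> intro z <;> rw [hE] <;> grind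
  · refine ⟨w, u, c, by simp [hV], ?_, ?_⟩ <;> intro z <;> rw [hE] <;> grind

lemma SplitVertex.linearAt (h : SplitVertex G G') (hG : G.WellFormed) {v a c : α}
    (hv : LinearAt G v a c) : ∃ v a c, LinearAt G' v a c := by
  obtain ⟨x, u, w, hx, hu, hw, huw, hV, hE⟩ := h
  have hE' := mem_E_of_split hE
  obtain ⟨hvV, hin, hout⟩ := hv
  by_cases hxv : x = v
  · subst hxv
    exact linearAt_of_split_of_unique hG hu hw huw hV hE' (Or.inl ⟨a, hin⟩)
  · have := hG.mem
    refine ⟨v, if a = x then w else a, if c = x then u else c, ?_, ?_, ?_⟩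
    · simp only [hV, Finset.mem_insert, Finset.mem_erase]
      grind
    all_goals
      intro z
      rw [hE']
      grind

end Splitting

namespace SplitDoubleCycle

variable {α : Type} {m : ℕ} {b b' : ZMod m → Bool} {p q p' q' : ZMod m → α} {G : FinDigraph α}

lemma wellFormed (hm : 3 ≤ m) (h : SplitDoubleCycle m b p q G) : G.WellFormed := by
  rintro ⟨x, y⟩ hxy
  obtain ⟨i, hi⟩ := (h.mem_E x y).1 hxy
  have : Fact (1 < m) := ⟨by omega⟩
  have h1 : i + 1 ≠ i := by simp
  have h2 : i - 1 ≠ i := by simp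
  have := h.cross
  simp only [h.mem_V]
  refine ⟨?_, ?_, ?_⟩ <;> grind

lemma nonlinear [DecidableEq α] (hm : 3 ≤ m) (h : SplitDoubleCycle m b p q G) :
    G.Nonlinear := by
  rintro v hv ⟨hin, hout⟩
  obtain ⟨i, rfl | rfl⟩ := (h.mem_V v).1 hv
  · have h1 : (q (i + 1), p i) ∈ G.E := (h.mem_E _ _).2 ⟨i + 1, by simp⟩
    have h2 : (q (i - 1), p i) ∈ G.E := (h.mem_E _ _).2 ⟨i - 1, by simp⟩
    have := Finset.card_le_one.1 hin.le _ (Finset.mem_filter.2 ⟨h1, rfl⟩) _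
      (Finset.mem_filter.2 ⟨h2, rfl⟩)
    exact ZMod.add_one_ne_sub_one hm i (h.inj_out (Prod.mk.inj this).1)
  · have h1 : (q i, p (i + 1)) ∈ G.E := (h.mem_E _ _).2 ⟨i, by simp⟩
    have h2 : (q i, p (i - 1)) ∈ G.E := (h.mem_E _ _).2 ⟨i, by simp⟩
    have := Finset.card_le_one.1 hout.le _ (Finset.mem_filter.2 ⟨h1, rfl⟩) _
      (Finset.mem_filter.2 ⟨h2, rfl⟩)
    exact ZMod.add_one_ne_sub_one hm i (h.inj_in (Prod.mk.inj this).2)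

lemma map {β : Type} [DecidableEq β] {H : FinDigraph β} {f : α → β}
    (h : SplitDoubleCycle m b p q G) (hf : DigraphIso G H f) :
    SplitDoubleCycle m b (f ∘ p) (f ∘ q) H := by
  obtain ⟨⟨hmaps, hinj, hsurj⟩, hE⟩ := hf
  have hp : ∀ i, p i ∈ (G.V : Set α) := fun i => (h.mem_V _).2 ⟨i, Or.inl rfl⟩
  have hq : ∀ i, q i ∈ (G.V : Set α) := fun i => (h.mem_V _).2 ⟨i, Or.inr rfl⟩
  refine ⟨fun i j hij => h.inj_in (hinj (hp i) (hp j) hij),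
    fun i j hij => h.inj_out (hinj (hq i) (hq j) hij),
    fun i j hij => h.cross i j (hinj (hp i) (hq j) hij),
    fun i hi => congrArg f (h.unsplit i hi), fun x => ⟨fun hx => ?_, ?_⟩, fun x y => ?_⟩
  · obtain ⟨a, ha, rfl⟩ := hsurj hx
    obtain ⟨i, rfl | rfl⟩ := (h.mem_V a).1 ha
    exacts [⟨i, Or.inl rfl⟩, ⟨i, Or.inr rfl⟩]
  · rintro ⟨i, rfl | rfl⟩
    exacts [hmaps (hp i), hmaps (hq i)]
  · rw [← hE]
    simp only [Finset.mem_image, Prod.mk.injEq, Prod.exists, h.mem_E, Function.comp_apply]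
    constructor
    · rintro ⟨x, y, ⟨i, hi⟩, rfl, rfl⟩
      exact ⟨i, by grind⟩
    · rintro ⟨i, ⟨hi, rfl, rfl⟩ | ⟨rfl, rfl | rfl⟩⟩
      exacts [⟨_, _, ⟨i, Or.inl ⟨hi, rfl, rfl⟩⟩, rfl, rfl⟩,
        ⟨_, _, ⟨i, Or.inr ⟨rfl, Or.inl rfl⟩⟩, rfl, rfl⟩,
        ⟨_, _, ⟨i, Or.inr ⟨rfl, Or.inr rfl⟩⟩, rfl, rfl⟩]

/-- Two digraphs with the same splitting pattern are isomorphic. -/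
lemma exists_iso {β : Type} [DecidableEq β] {H : FinDigraph β} {p' q' : ZMod m → β}
    (h : SplitDoubleCycle m b p q G) (h' : SplitDoubleCycle m b p' q' H) :
    ∃ f : α → β, DigraphIso G H f := by
  classical
  let f : α → β := fun x =>
    if hx : ∃ i, x = p i then p' hx.choose else
      if hx : ∃ i, x = q i then q' hx.choose else p' 0
  have hfp : ∀ i, f (p i) = p' i := fun i => by
    have hx : ∃ j, p i = p j := ⟨i, rfl⟩
    simp only [f, dif_pos hx]
    rw [← h.inj_in hx.choose_spec]
  have hfq : ∀ i, f (q i) = q' i := fun i => by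
    by_cases hx : ∃ j, q i = p j
    · obtain ⟨j, hj⟩ := hx
      obtain ⟨rfl, hb⟩ := h.cross _ _ hj.symm
      rw [hj, hfp, h'.unsplit _ hb]
    · have hx' : ∃ j, q i = q j := ⟨i, rfl⟩
      simp only [f, dif_neg hx, dif_pos hx']
      rw [← h.inj_out hx'.choose_spec]
  clear_value f
  refine ⟨f, ⟨fun x hx => ?_, fun x hx y hy hxy => ?_, fun y hy => ?_⟩, ?_⟩
  · obtain ⟨i, rfl | rfl⟩ := (h.mem_V x).1 hx
    · exact (h'.mem_V _).2 ⟨i, Or.inl (hfp i)⟩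
    · exact (h'.mem_V _).2 ⟨i, Or.inr (hfq i)⟩
  · obtain ⟨i, rfl | rfl⟩ := (h.mem_V x).1 hx <;> obtain ⟨j, rfl | rfl⟩ := (h.mem_V y).1 hy <;>
      simp only [hfp, hfq] at hxy
    · rw [h'.inj_in hxy]
    · obtain ⟨rfl, hb⟩ := h'.cross _ _ hxy
      exact h.unsplit _ hb
    · obtain ⟨rfl, hb⟩ := h'.cross _ _ hxy.symm
      exact (h.unsplit _ hb).symm
    · rw [h'.inj_out hxy]
  · obtain ⟨i, rfl | rfl⟩ := (h'.mem_V y).1 hy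
    · exact ⟨p i, (h.mem_V _).2 ⟨i, Or.inl rfl⟩, hfp i⟩
    · exact ⟨q i, (h.mem_V _).2 ⟨i, Or.inr rfl⟩, hfq i⟩
  · ext ⟨x, y⟩
    rw [h'.mem_E]
    simp only [Finset.mem_image, Prod.mk.injEq, Prod.exists, h.mem_E]
    constructor
    · rintro ⟨x, y, ⟨i, hi⟩, rfl, rfl⟩
      exact ⟨i, by grind⟩
    · rintro ⟨i, ⟨hi, rfl, rfl⟩ | ⟨rfl, rfl | rfl⟩⟩
      exacts [⟨p i, q i, ⟨i, Or.inl ⟨hi, rfl, rfl⟩⟩, hfp _, hfq _⟩,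
        ⟨q i, p (i + 1), ⟨i, Or.inr ⟨rfl, Or.inl rfl⟩⟩, hfq _, hfp _⟩,
        ⟨q i, p (i - 1), ⟨i, Or.inr ⟨rfl, Or.inr rfl⟩⟩, hfq _, hfp _⟩]

lemma of_braceletRel (h : SplitDoubleCycle m b p q G) (hb : BraceletRel m b b') :
    ∃ p' q', SplitDoubleCycle m b' p' q' G := by
  obtain ⟨r, s, hrs⟩ := hb
  let σ : ZMod m → ZMod m := fun i => if s then r - i else i + r
  have hσb : ∀ i, b' i = b (σ i) := hrs
  have hinj : Function.Injective σ := by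
    intro i j hij
    cases s <;> simpa [σ] using hij
  have hsurj : Function.Surjective σ := by
    intro i
    cases s
    · exact ⟨i - r, by simp [σ]⟩
    · exact ⟨r - i, by simp [σ]⟩
  have hstep : ∀ i, (σ (i + 1) = σ i + 1 ∧ σ (i - 1) = σ i - 1) ∨
      (σ (i + 1) = σ i - 1 ∧ σ (i - 1) = σ i + 1) := by
    intro i
    cases s
    · left; simp only [σ]; constructor <;> simp <;> ring
    · right; simp only [σ]; constructor <;> simp <;> ring
  refine ⟨p ∘ σ, q ∘ σ, h.inj_in.comp hinj, h.inj_out.comp hinj, fun i j hij => ?_,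
    fun i hi => h.unsplit _ (by rw [← hσb, hi]), fun x => ?_, fun x y => ?_⟩
  · obtain ⟨h1, h2⟩ := h.cross _ _ hij
    exact ⟨hinj h1, by rw [hσb, h2]⟩
  · rw [h.mem_V, hsurj.exists]
    rfl
  · rw [h.mem_E, hsurj.exists]
    refine exists_congr fun i => ?_
    simp only [Function.comp_apply, hσb]
    rcases hstep i with ⟨h1, h2⟩ | ⟨h1, h2⟩ <;> rw [h1, h2]
    rw [or_comm (a := y = p (σ i + 1))]

lemma mem_range_in_iff (hm : 3 ≤ m) (h : SplitDoubleCycle m b p q G) (x : α) :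
    (∃ i, x = p i) ↔ ∃ y z, y ≠ z ∧ (y, x) ∈ G.E ∧ (z, x) ∈ G.E := by
  constructor
  · rintro ⟨i, rfl⟩
    exact ⟨q (i + 1), q (i - 1), h.inj_out.ne (ZMod.add_one_ne_sub_one hm i),
      (h.mem_E _ _).2 ⟨i + 1, by simp⟩, (h.mem_E _ _).2 ⟨i - 1, by simp⟩⟩
  · rintro ⟨y, z, hyz, hy, hz⟩
    obtain ⟨i, hi⟩ := (h.mem_E _ _).1 hy
    obtain ⟨j, hj⟩ := (h.mem_E _ _).1 hz
    have := @h.inj_out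
    grind [Function.Injective]

lemma mem_range_out_iff (hm : 3 ≤ m) (h : SplitDoubleCycle m b p q G) (x : α) :
    (∃ i, x = q i) ↔ ∃ y z, y ≠ z ∧ (x, y) ∈ G.E ∧ (x, z) ∈ G.E := by
  constructor
  · rintro ⟨i, rfl⟩
    exact ⟨p (i + 1), p (i - 1), h.inj_in.ne (ZMod.add_one_ne_sub_one hm i),
      (h.mem_E _ _).2 ⟨i, by simp⟩, (h.mem_E _ _).2 ⟨i, by simp⟩⟩
  · rintro ⟨y, z, hyz, hy, hz⟩
    obtain ⟨i, hi⟩ := (h.mem_E _ _).1 hy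
    obtain ⟨j, hj⟩ := (h.mem_E _ _).1 hz
    have := @h.inj_in
    grind [Function.Injective]

end SplitDoubleCycle

/-- An injective graph endomorphism of the cycle is a rotation or a reflection. -/
lemma ZMod.eq_rotation_or_reflection {m : ℕ} (hm : 3 ≤ m) {σ : ZMod m → ZMod m}
    (hinj : Function.Injective σ) (hstep : ∀ i, σ (i + 1) = σ i + 1 ∨ σ (i + 1) = σ i - 1) :
    ∃ (r : ZMod m) (s : Bool), ∀ i, σ i = if s then r - i else i + r := by
  have : NeZero m := ⟨by omega⟩
  have hturn : ∀ i, σ (i + 1 + 1) ≠ σ i := fun i hi => by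
    apply ZMod.two_ne_zero_of_three_le hm
    linear_combination hinj hi
  rcases hstep 0 with h0 | h0
  · refine ⟨σ 0, false, ?_⟩
    have key : ∀ n : ℕ, σ n = n + σ 0 ∧ σ (n + 1) = σ n + 1 := by
      intro n
      induction n with
      | zero => simpa using h0
      | succ n ih =>
        push_cast
        refine ⟨by rw [ih.2, ih.1]; ring, (hstep _).resolve_right fun h => hturn n ?_⟩
        rw [h, ih.2]; ring
    intro i
    simpa using (key i.val).1
  · refine ⟨σ 0, true, ?_⟩
    have key : ∀ n : ℕ, σ n = σ 0 - n ∧ σ (n + 1) = σ n - 1 := by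
      intro n
      induction n with
      | zero => simpa using h0
      | succ n ih =>
        push_cast
        refine ⟨by rw [ih.2, ih.1]; ring, (hstep _).resolve_left fun h => hturn n ?_⟩
        rw [h, ih.2]; ring
    intro i
    simpa using (key i.val).1

namespace SplitDoubleCycle

variable {α : Type} {m : ℕ} {b b' : ZMod m → Bool} {p q p' q' : ZMod m → α} {G : FinDigraph α}

/-- The splitting pattern is determined up to rotation and reflection. -/
lemma braceletRel (hm : 3 ≤ m) (h : SplitDoubleCycle m b p q G)
    (h' : SplitDoubleCycle m b' p' q' G) : BraceletRel m b b' := by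
  have hp : ∀ i, ∃ j, p' i = p j := fun i =>
    (h.mem_range_in_iff hm _).2 ((h'.mem_range_in_iff hm _).1 ⟨i, rfl⟩)
  have hq : ∀ i, ∃ j, q' i = q j := fun i =>
    (h.mem_range_out_iff hm _).2 ((h'.mem_range_out_iff hm _).1 ⟨i, rfl⟩)
  have hq' : ∀ i, ∃ j, q i = q' j := fun i =>
    (h'.mem_range_out_iff hm _).2 ((h.mem_range_out_iff hm _).1 ⟨i, rfl⟩)
  choose σ hσ using hp
  choose τ hτ using hq
  have hbσ : ∀ i, b' i = b (σ i) := by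
    intro i
    have h1 : b' i = false ↔ b (σ i) = false := by
      constructor
      · intro hi
        exact (h.cross (σ i) (τ i) (by rw [← hσ, ← hτ, h'.unsplit i hi])).2
      · intro hi
        obtain ⟨j, hj⟩ := hq' (σ i)
        exact (h'.cross i j (by rw [hσ, h.unsplit _ hi, hj])).2
    cases hb : b (σ i) <;> cases hb' : b' i <;> simp_all
  have hστ : ∀ i, τ i = σ i := by
    intro i
    cases hi : b' i with
    | false => exact (h.cross (σ i) (τ i) (by rw [← hσ, ← hτ, h'.unsplit i hi])).1.symm
    | true =>
      have hE : (p (σ i), q (τ i)) ∈ G.E := by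
        rw [← hσ, ← hτ]
        exact (h'.mem_E _ _).2 ⟨i, Or.inl ⟨hi, rfl, rfl⟩⟩
      obtain ⟨j, ⟨-, h1, h2⟩ | ⟨h1, -⟩⟩ := (h.mem_E _ _).1 hE
      · rw [h.inj_in h1, h.inj_out h2]
      · have := (h.cross _ _ h1).2
        rw [← hbσ, hi] at this
        cases this
  have hinj : Function.Injective σ := fun i j hij => h'.inj_in (by rw [hσ, hσ, hij])
  have hstep : ∀ i, σ (i + 1) = σ i + 1 ∨ σ (i + 1) = σ i - 1 := by
    intro i
    have hE : (q (σ i), p (σ (i + 1))) ∈ G.E := by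
      rw [← hσ, ← hστ, ← hτ]
      exact (h'.mem_E _ _).2 ⟨i, by simp⟩
    obtain ⟨j, ⟨hj, h1, -⟩ | ⟨h1, h2⟩⟩ := (h.mem_E _ _).1 hE
    · have := (h.cross _ _ h1.symm).2
      rw [hj] at this
      cases this
    · rw [h.inj_out h1]
      exact h2.imp (@h.inj_in _ _) (@h.inj_in _ _)
  obtain ⟨r, s, hrs⟩ := ZMod.eq_rotation_or_reflection hm hinj hstep
  exact ⟨r, s, fun i => by rw [hbσ, hrs]⟩

variable [DecidableEq α] {G' : FinDigraph α}

/-- Splitting an unsplit vertex of a split double cycle. -/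
lemma split (hm : 3 ≤ m) (h : SplitDoubleCycle m b p q G) {i : ZMod m} (hi : b i = false)
    {u w : α} (hu : u ∉ G.V) (hw : w ∉ G.V) (huw : u ≠ w)
    (hV : G'.V = insert u (insert w (G.V.erase (p i))))
    (hE : ∀ y z, (y, z) ∈ G'.E ↔ (y = u ∧ z = w) ∨ ((y, z) ∈ G.E ∧ y ≠ p i ∧ z ≠ p i) ∨
      ((y, p i) ∈ G.E ∧ z = u) ∨ ((p i, z) ∈ G.E ∧ y = w)) :
    SplitDoubleCycle m (Function.update b i true) (Function.update p i u)
      (Function.update q i w) G' := by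
  have hup : ∀ j, u ≠ p j := fun j hj => hu ((h.mem_V _).2 ⟨j, Or.inl hj⟩)
  have huq : ∀ j, u ≠ q j := fun j hj => hu ((h.mem_V _).2 ⟨j, Or.inr hj⟩)
  have hwp : ∀ j, w ≠ p j := fun j hj => hw ((h.mem_V _).2 ⟨j, Or.inl hj⟩)
  have hwq : ∀ j, w ≠ q j := fun j hj => hw ((h.mem_V _).2 ⟨j, Or.inr hj⟩)
  have hpq := h.unsplit i hi
  have hpi : ∀ j k, p j = p k → j = k := fun j k => @h.inj_in j k
  have hqi : ∀ j k, q j = q k → j = k := fun j k => @h.inj_out j k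
  have hc := h.cross
  have hun := h.unsplit
  have : Fact (1 < m) := ⟨by omega⟩
  have hne1 : ∀ j : ZMod m, j + 1 ≠ j := fun j => by simp
  have hne2 : ∀ j : ZMod m, j - 1 ≠ j := fun j => by simp
  refine ⟨?_, ?_, ?_, ?_, ?_, ?_⟩
  · intro j k hjk
    simp only [Function.update_apply] at hjk
    grind
  · intro j k hjk
    simp only [Function.update_apply] at hjk
    grind
  · intro j k hjk
    simp only [Function.update_apply] at hjk ⊢
    grind
  · intro j hj
    simp only [Function.update_apply] at hj ⊢
    grind
  · intro x
    simp only [hV, Finset.mem_insert, Finset.mem_erase, h.mem_V, Function.update_apply]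
    constructor
    · rintro (rfl | rfl | ⟨hx, j, hj⟩)
      · exact ⟨i, by simp⟩
      · exact ⟨i, by simp⟩
      · exact ⟨j, by grind⟩
    · rintro ⟨j, hj⟩
      by_cases hji : j = i
      · grind
      · right; right
        exact ⟨by grind, j, by grind⟩
  · intro x y
    rw [hE]
    simp only [h.mem_E, Function.update_apply]
    constructor
    · rintro (⟨rfl, rfl⟩ | ⟨⟨j, hj⟩, hx, hy⟩ | ⟨⟨j, hj⟩, rfl⟩ | ⟨⟨j, hj⟩, rfl⟩)
      · exact ⟨i, by simp⟩
      · exact ⟨j, by grind⟩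
      · exact ⟨j, by grind⟩
      · exact ⟨j, by grind⟩
    · rintro ⟨j, hj⟩
      by_cases hji : j = i
      · subst hji
        simp only [if_true] at hj
        rcases hj with ⟨-, rfl, rfl⟩ | ⟨rfl, hy⟩
        · simp
        · right; right; right
          exact ⟨⟨j, Or.inr ⟨hpq, by grind⟩⟩, rfl⟩
      · simp only [if_neg hji] at hj
        rcases hj with ⟨hb, rfl, rfl⟩ | ⟨rfl, hy⟩
        · right; left
          exact ⟨⟨j, Or.inl ⟨hb, rfl, rfl⟩⟩, by grind, by grind⟩
        · rcases hy with hy | hy <;> split_ifs at hy with hk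
          · right; right; left
            exact ⟨⟨j, Or.inr ⟨rfl, by grind⟩⟩, hy⟩
          · right; left
            exact ⟨⟨j, Or.inr ⟨rfl, Or.inl hy⟩⟩, by grind, by grind⟩
          · right; right; left
            exact ⟨⟨j, Or.inr ⟨rfl, by grind⟩⟩, hy⟩
          · right; left
            exact ⟨⟨j, Or.inr ⟨rfl, Or.inr hy⟩⟩, by grind, by grind⟩

/-- Splitting a vertex of a split double cycle yields a split double cycle or a digraph with a
linear vertex. -/
lemma splitVertex (hm : 3 ≤ m) (h : SplitDoubleCycle m b p q G) (hs : SplitVertex G G') :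
    (∃ v a c, LinearAt G' v a c) ∨ ∃ b p q, SplitDoubleCycle m b p q G' := by
  obtain ⟨x, u, w, hx, hu, hw, huw, hV, hE⟩ := hs
  have hE' := mem_E_of_split hE
  obtain ⟨i, hxi⟩ := (h.mem_V x).1 hx
  cases hi : b i with
  | false =>
    have : x = p i := hxi.elim id fun hq => hq.trans (h.unsplit i hi).symm
    subst this
    exact Or.inr ⟨_, _, _, h.split hm hi hu hw huw hV hE'⟩
  | true =>
    refine Or.inl (linearAt_of_split_of_unique (h.wellFormed hm) hu hw huw hV hE' ?_)
    have hc := h.cross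
    rcases hxi with rfl | rfl
    · refine Or.inr ⟨q i, fun y => ?_⟩
      rw [h.mem_E]
      constructor
      · rintro ⟨j, ⟨-, hj, rfl⟩ | ⟨hj, -⟩⟩
        · rw [h.inj_in hj]
        · grind
      · rintro rfl
        exact ⟨i, Or.inl ⟨hi, rfl, rfl⟩⟩
    · refine Or.inl ⟨p i, fun y => ?_⟩
      rw [h.mem_E]
      constructor
      · rintro ⟨j, ⟨-, rfl, hj⟩ | ⟨-, hj | hj⟩⟩
        · rw [h.inj_out hj]
        · grind
        · grind
      · rintro rfl
        exact ⟨i, Or.inl ⟨hi, rfl, rfl⟩⟩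

end SplitDoubleCycle

lemma splitDoubleCycle_stdDoubleCycle {m : ℕ} (hm : 3 ≤ m) :
    SplitDoubleCycle m (fun _ => false) ZMod.val ZMod.val (stdDoubleCycle m) := by
  have : NeZero m := ⟨by omega⟩
  have : Fact (1 < m) := ⟨by omega⟩
  have hinj := ZMod.val_injective m
  have hsucc : ∀ i : ZMod m, (i + 1).val = (i.val + 1) % m := fun i => by
    rw [ZMod.val_add, ZMod.val_one]
  refine ⟨hinj, hinj, fun i j hij => ⟨hinj hij, rfl⟩, fun _ _ => rfl, fun x => ?_, fun x y => ?_⟩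
  · simp only [stdDoubleCycle, Finset.mem_range, or_self]
    exact ⟨fun hx => ⟨(x : ZMod m), (ZMod.val_cast_of_lt hx).symm⟩,
      fun ⟨i, hi⟩ => hi ▸ ZMod.val_lt i⟩
  · simp only [stdDoubleCycle, Finset.mem_biUnion, Finset.mem_range, Finset.mem_insert,
      Finset.mem_singleton, Prod.mk.injEq, Bool.false_eq_true, false_and, false_or]
    constructor
    · rintro ⟨k, hk, hxy⟩
      obtain ⟨i, rfl⟩ : ∃ i : ZMod m, i.val = k := ⟨(k : ZMod m), ZMod.val_cast_of_lt hk⟩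
      rw [← hsucc] at hxy
      rcases hxy with ⟨rfl, rfl⟩ | ⟨rfl, rfl⟩
      · exact ⟨i, by simp⟩
      · exact ⟨i + 1, by simp⟩
    · rintro ⟨i, rfl, rfl | rfl⟩
      · exact ⟨i.val, ZMod.val_lt i, Or.inl ⟨rfl, hsucc i⟩⟩
      · exact ⟨(i - 1).val, ZMod.val_lt _, Or.inr ⟨by rw [← hsucc]; simp, rfl⟩⟩

lemma IsWDC.linearAt_or_splitDoubleCycle {α : Type} [DecidableEq α] {m : ℕ} {G : FinDigraph α}
    (h : IsWDC m G) : G.WellFormed ∧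
      ((∃ v a c, LinearAt G v a c) ∨ ∃ b p q, SplitDoubleCycle m b p q G) := by
  obtain ⟨G₀, ⟨hm, f, hf⟩, hG⟩ := h
  induction hG with
  | refl =>
    have := (splitDoubleCycle_stdDoubleCycle hm).map hf
    exact ⟨this.wellFormed hm, Or.inr ⟨_, _, _, this⟩⟩
  | tail _ hs ih =>
    obtain ⟨hwf, ih⟩ := ih
    rcases hs with hs | hs
    · refine ⟨hs.wellFormed hwf, ?_⟩
      rcases ih with ⟨v, a, c, hv⟩ | ⟨b, p, q, hb⟩
      · exact Or.inl (hs.linearAt hwf hv)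
      · exact hb.splitVertex hm hs
    · exact ⟨hs.wellFormed hwf, Or.inl (hs.linearAt hwf)⟩

lemma IsWDC.exists_splitDoubleCycle {α : Type} [DecidableEq α] {m : ℕ} {G : FinDigraph α}
    (h : IsWDC m G) (hn : G.Nonlinear) : ∃ b p q, SplitDoubleCycle m b p q G :=
  h.linearAt_or_splitDoubleCycle.2.resolve_left fun ⟨_, _, _, hv⟩ => hv.not_nonlinear hn

/-- Every splitting pattern is realised by some weak double cycle. -/
lemma exists_isWDC_splitDoubleCycle {m : ℕ} (hm : 3 ≤ m) (b : ZMod m → Bool) :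
    ∃ G : FinDigraph ℕ, IsWDC m G ∧ ∃ p q, SplitDoubleCycle m b p q G := by
  have : NeZero m := ⟨by omega⟩
  suffices ∀ s : Finset (ZMod m), ∃ G : FinDigraph ℕ, IsWDC m G ∧
      ∃ p q, SplitDoubleCycle m (fun i => decide (i ∈ s)) p q G by
    convert this (Finset.univ.filter fun i => b i = true) using 6
    simp
  intro s
  induction s using Finset.induction_on with
  | empty =>
    refine ⟨stdDoubleCycle m, ⟨_, ⟨hm, id, Set.bijOn_id _, by simp⟩, .refl⟩, ZMod.val, ZMod.val, ?_⟩
    simpa using splitDoubleCycle_stdDoubleCycle hm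
  | insert i s hi ih =>
    obtain ⟨G, ⟨G₀, hG₀, hG⟩, p, q, h⟩ := ih
    obtain ⟨u, hu⟩ := Infinite.exists_notMem_finset G.V
    obtain ⟨w, hw⟩ := Infinite.exists_notMem_finset (insert u G.V)
    simp only [Finset.mem_insert, not_or] at hw
    let G' : FinDigraph ℕ := ⟨insert u (insert w (G.V.erase (p i))), insert (u, w)
      ((G.E.filter (fun e => e.1 ≠ p i ∧ e.2 ≠ p i)) ∪
       ((G.E.filter (fun e => e.2 = p i)).image (fun e => (e.1, u))) ∪
       ((G.E.filter (fun e => e.1 = p i)).image (fun e => (w, e.2))))⟩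
    have huw : u ≠ w := Ne.symm hw.1
    have hs : SplitVertex G G' :=
      ⟨p i, u, w, (h.mem_V _).2 ⟨i, Or.inl rfl⟩, hu, hw.2, huw, rfl, rfl⟩
    refine ⟨G', ⟨G₀, hG₀, hG.tail (Or.inl hs)⟩, Function.update p i u,
      Function.update q i w, ?_⟩
    convert h.split hm (i := i) (by simpa using hi) hu hw.2 huw rfl
      (mem_E_of_split (G' := G') rfl) using 1
    ext j
    by_cases hj : j = i <;> simp [hj]

theorem stmt14 (m : ℕ) (hm : 3 ≤ m) :
    Nonempty (Quot (NonlinWDCRel m) ≃ Quot (BraceletRel m)) := by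
  have hpat : ∀ G : {G : FinDigraph ℕ // IsWDC m G ∧ G.Nonlinear},
      ∃ b p q, SplitDoubleCycle m b p q G.1 := fun G => G.2.1.exists_splitDoubleCycle G.2.2
  have hreal : ∀ b : ZMod m → Bool, ∃ G : {G : FinDigraph ℕ // IsWDC m G ∧ G.Nonlinear},
      ∃ p q, SplitDoubleCycle m b p q G.1 := fun b => by
    obtain ⟨G, hG, p, q, h⟩ := exists_isWDC_splitDoubleCycle hm b
    exact ⟨⟨G, hG, h.nonlinear hm⟩, p, q, h⟩
  choose pat p q hpat using hpat
  choose real p' q' hreal using hreal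
  refine ⟨⟨Quot.map pat ?_, Quot.map real ?_, ?_, ?_⟩⟩
  · rintro G H ⟨f, hf⟩
    exact ((hpat G).map hf).braceletRel hm (hpat H)
  · intro b b' hb
    obtain ⟨_, _, h⟩ := (hreal b).of_braceletRel hb
    exact h.exists_iso (hreal b')
  · rintro ⟨G⟩
    exact Quot.sound ((hreal (pat G)).exists_iso (hpat G))
  · rintro ⟨b⟩
    exact Quot.sound ((hpat (real b)).braceletRel hm (hreal b))
end
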